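/- Let G be a finite Frattini-free group. Then G has property B and every independent subset of G extends to a minimal generating set of G (i.e., G is a matroid group) if and only if one of the following holds: (1) G is an elementary abelian p-group for some prime p; or (2) there exist primes p and q with q dividing p − 1, subgroups P and Q of G with P a normal elementary abelian p-subgroup, Q cyclic of order q, P ∩ Q = 1 and PQ = G, and an injective homomorphism χ from Q to the multiplicative group of the field F_p such that for all y in Q and x in P one has y·x·y⁻¹ = x^{χ(y)}. -/

import Mathlib

/-- A subset `X` of a group `G` is a minimal generating set if it generates `G`
and no proper subset of `X` generates `G`. -/
def IsMinimalGenSet {G : Type*} [Group G] (X : Set G) : Prop :=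
  Subgroup.closure X = ⊤ ∧ ∀ Y : Set G, Y ⊂ X → Subgroup.closure Y ≠ ⊤

/-- A group has property `B` if all its minimal generating sets have the same size. -/
def HasPropB (G : Type*) [Group G] : Prop :=
  ∀ X Y : Set G, IsMinimalGenSet X → IsMinimalGenSet Y → X.ncard = Y.ncard

/-- `dGen G` is the smallest size of a minimal generating set of `G`. -/
noncomputable def dGen (G : Type*) [Group G] : ℕ :=
  sInf {n | ∃ X : Set G, IsMinimalGenSet X ∧ X.ncard = n}

/-- `mGen G` is the largest size of a minimal generating set of `G`. -/
noncomputable def mGen (G : Type*) [Group G] : ℕ :=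
  sSup {n | ∃ X : Set G, IsMinimalGenSet X ∧ X.ncard = n}

/-- A subset `X` of a group is independent if no proper subset of `X`
generates the same subgroup as `X`. -/
def IsIndepSet {G : Type*} [Group G] (X : Set G) : Prop :=
  ∀ Y : Set G, Y ⊂ X → Subgroup.closure Y ≠ Subgroup.closure X

/-- A group is a matroid group if it has property B and every independent
subset extends to a minimal generating set. -/
def IsMatroidGroup (G : Type*) [Group G] : Prop :=
  HasPropB G ∧ ∀ X : Set G, IsIndepSet X → ∃ Z : Set G, X ⊆ Z ∧ IsMinimalGenSet Z

/-! ### Independent sets and minimal generating sets -/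

theorem isIndepSet_iff {G : Type*} [Group G] {X : Set G} :
    IsIndepSet X ↔ ∀ x ∈ X, x ∉ Subgroup.closure (X \ {x}) := by
  constructor
  · intro h x hx hmem
    refine h (X \ {x}) ⟨Set.sdiff_subset, fun hsub => (hsub hx).2 rfl⟩ ?_
    refine le_antisymm (Subgroup.closure_mono Set.sdiff_subset) ?_
    rw [Subgroup.closure_le]
    intro y hy
    by_cases hyx : y = x
    · exact hyx ▸ hmem
    · exact Subgroup.subset_closure ⟨hy, hyx⟩
  · intro h Y hY heq
    obtain ⟨x, hx, hxY⟩ := Set.exists_of_ssubset hY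
    refine h x hx ?_
    have : x ∈ Subgroup.closure Y := heq ▸ Subgroup.subset_closure hx
    exact Subgroup.closure_mono (k := X \ {x})
      (fun y hy => ⟨hY.1 hy, fun hyx => hxY (Set.mem_singleton_iff.1 hyx ▸ hy)⟩) this

theorem isMinimalGenSet_iff {G : Type*} [Group G] {X : Set G} :
    IsMinimalGenSet X ↔ Subgroup.closure X = ⊤ ∧ IsIndepSet X := by
  constructor
  · rintro ⟨h, h'⟩
    exact ⟨h, fun Y hY => h ▸ h' Y hY⟩
  · rintro ⟨h, h'⟩
    exact ⟨h, fun Y hY => h ▸ h' Y hY⟩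

/-- Among the subsets of a set, one that is minimal with the same closure. -/
theorem exists_indep_subset_closure_eq {G : Type*} [Group G] [Finite G] (X : Set G) :
    ∃ Y ⊆ X, IsIndepSet Y ∧ Subgroup.closure Y = Subgroup.closure X := by
  obtain ⟨Y, ⟨hYX, hY⟩, hmin⟩ := (Set.toFinite
    {Y : Set G | Y ⊆ X ∧ Subgroup.closure Y = Subgroup.closure X}).exists_minimal
    ⟨X, subset_rfl, rfl⟩
  refine ⟨Y, hYX, fun Z hZ hcl => ?_, hY⟩
  exact hZ.2 (hmin ⟨hZ.1.trans hYX, hcl.trans hY⟩ hZ.1)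

theorem closure_insert_eq_sup_zpowers {G : Type*} [Group G] (x : G) (X : Set G) :
    Subgroup.closure (insert x X) = Subgroup.closure X ⊔ Subgroup.zpowers x := by
  rw [Set.insert_eq, Subgroup.closure_union, Subgroup.zpowers_eq_closure, sup_comm]

/-! ### The exchange property makes a group a matroid group -/

/-- The exchange property of the closure operator of a group. -/
def HasExchange (G : Type*) [Group G] : Prop :=
  ∀ (H : Subgroup G) (x y : G),
    y ∈ H ⊔ Subgroup.zpowers x → y ∉ H → x ∈ H ⊔ Subgroup.zpowers y

theorem HasExchange.isIndepSet_insert {G : Type*} [Group G] (hG : HasExchange G) {X : Set G}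
    (hX : IsIndepSet X) {y : G} (hy : y ∉ Subgroup.closure X) : IsIndepSet (insert y X) := by
  rw [isIndepSet_iff] at hX ⊢
  have hyX : y ∉ X := fun h => hy (Subgroup.subset_closure h)
  rintro x (rfl | hx) hmem
  · refine hy (Subgroup.closure_mono ?_ hmem)
    rintro z ⟨rfl | hz, hzx⟩
    · exact absurd rfl hzx
    · exact hz
  · have hxy : y ≠ x := fun h => hyX (h ▸ hx)
    have hset : insert y X \ {x} = insert y (X \ {x}) := by
      rw [Set.insert_sdiff_of_notMem _ (by simpa using hxy)]
    rw [hset, closure_insert_eq_sup_zpowers] at hmem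
    have := hG _ _ _ hmem (hX x hx)
    rw [← closure_insert_eq_sup_zpowers, Set.insert_sdiff_singleton,
      Set.insert_eq_of_mem hx] at this
    exact hy this

theorem HasExchange.exists_isMinimalGenSet {G : Type*} [Group G] [Finite G] (hG : HasExchange G)
    {X : Set G} (hX : IsIndepSet X) : ∃ Z, X ⊆ Z ∧ IsMinimalGenSet Z := by
  obtain ⟨Z, ⟨hXZ, hZ⟩, hmax⟩ := (Set.toFinite {Z : Set G | X ⊆ Z ∧ IsIndepSet Z}).exists_maximal
    ⟨X, subset_rfl, hX⟩
  refine ⟨Z, hXZ, isMinimalGenSet_iff.2 ⟨?_, hZ⟩⟩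
  by_contra hne
  obtain ⟨y, hy⟩ : ∃ y, y ∉ Subgroup.closure Z := by
    by_contra! h
    exact hne ((Subgroup.eq_top_iff' _).2 h)
  have := hmax ⟨hXZ.trans (Set.subset_insert y Z), hG.isIndepSet_insert hZ hy⟩
    (Set.subset_insert y Z)
  exact hy (Subgroup.subset_closure (this (Set.mem_insert y Z)))

theorem HasExchange.hasPropB {G : Type*} [Group G] [Finite G] (hG : HasExchange G) :
    HasPropB G := by
  suffices ∀ (n : ℕ) (X Y : Set G), IsMinimalGenSet X → IsMinimalGenSet Y → (X \ Y).ncard = n →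
      X.ncard = Y.ncard from fun X Y hX hY => this _ X Y hX hY rfl
  intro n
  induction n with
  | zero =>
    intro X Y hX hY h
    have hXY : X ⊆ Y := by
      rw [Set.ncard_eq_zero (Set.toFinite _)] at h
      exact Set.sdiff_eq_empty.1 h
    rcases hXY.eq_or_ssubset with rfl | hss
    · rfl
    · exact absurd hX.1 (hY.2 X hss)
  | succ n ih =>
    intro X Y hX hY h
    obtain ⟨x, hxX, hxY⟩ : (X \ Y).Nonempty := by
      rw [← Set.ncard_pos (Set.toFinite _)]; omega
    have hind := (isMinimalGenSet_iff.1 hX).2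
    have hx := isIndepSet_iff.1 hind x hxX
    obtain ⟨y, hyY, hy⟩ : ∃ y ∈ Y, y ∉ Subgroup.closure (X \ {x}) := by
      by_contra! hcon
      have := (Subgroup.closure_le _).2 hcon
      rw [hY.1] at this
      exact hx (this trivial)
    have hgen : Subgroup.closure (insert y (X \ {x})) = ⊤ := by
      have hmem : y ∈ Subgroup.closure (X \ {x}) ⊔ Subgroup.zpowers x := by
        rw [← closure_insert_eq_sup_zpowers, Set.insert_sdiff_singleton, Set.insert_eq_of_mem hxX,
          hX.1]
        trivial
      have := hG _ _ _ hmem hy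
      rw [← closure_insert_eq_sup_zpowers] at this
      rw [eq_top_iff, ← hX.1, Subgroup.closure_le]
      intro z hz
      by_cases hzx : z = x
      · exact hzx ▸ this
      · exact Subgroup.subset_closure (Or.inr ⟨hz, hzx⟩)
    have hsub : IsIndepSet (X \ {x}) := by
      rw [isIndepSet_iff] at hind ⊢
      intro z hz hmem
      exact hind z hz.1 (Subgroup.closure_mono (Set.sdiff_subset_sdiff_left Set.sdiff_subset) hmem)
    have hyX : y ∉ X \ {x} := fun h => hy (Subgroup.subset_closure h)
    have hnew : IsMinimalGenSet (insert y (X \ {x})) :=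
      isMinimalGenSet_iff.2 ⟨hgen, hG.isIndepSet_insert hsub hy⟩
    rw [← ih _ Y hnew hY ?_, Set.ncard_insert_of_notMem hyX, Set.ncard_sdiff_singleton_add_one hxX]
    have : insert y (X \ {x}) \ Y = (X \ Y) \ {x} := by
      ext z
      simp only [Set.mem_sdiff, Set.mem_insert_iff, Set.mem_singleton_iff]
      constructor
      · rintro ⟨rfl | ⟨h1, h2⟩, h3⟩
        · exact absurd hyY h3
        · exact ⟨⟨h1, h3⟩, h2⟩
      · rintro ⟨⟨h1, h2⟩, h3⟩
        exact ⟨Or.inr ⟨h1, h3⟩, h2⟩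
    rw [this, Set.ncard_sdiff_singleton_of_mem (show x ∈ X \ Y from ⟨hxX, hxY⟩), h]
    rfl

theorem HasExchange.isMatroidGroup {G : Type*} [Group G] [Finite G] (hG : HasExchange G) :
    IsMatroidGroup G :=
  ⟨hG.hasPropB, fun _ hX => hG.exists_isMinimalGenSet hX⟩

/-- Replacing `x` by a nontrivial power of it, when `x` has prime order. -/
theorem mem_zpowers_of_zpow_ne_one {G : Type*} [Group G] {p : ℕ} (hp : p.Prime) {x : G}
    (hx : x ^ p = 1) {k : ℤ} (hk : x ^ k ≠ 1) : x ∈ Subgroup.zpowers (x ^ k) := by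
  have hcop : IsCoprime (p : ℤ) k := by
    rw [(Nat.prime_iff_prime_int.1 hp).coprime_iff_not_dvd]
    rintro ⟨m, rfl⟩
    exact hk (by rw [zpow_mul, zpow_natCast, hx, one_zpow])
  obtain ⟨a, b, hab⟩ := hcop
  refine ⟨b, ?_⟩
  calc (x ^ k) ^ b = (x ^ (p : ℤ)) ^ a * (x ^ k) ^ b := by simp [hx]
    _ = x ^ (a * p + b * k) := by rw [← zpow_mul, ← zpow_mul, ← zpow_add]; ring_nf
    _ = x := by rw [hab, zpow_one]

theorem exchange_of_normal {G : Type*} [Group G] {p : ℕ} (hp : p.Prime) {H : Subgroup G} {x y : G}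
    (hx : x ^ p = 1) (hn : H ≤ Subgroup.normalizer (Subgroup.zpowers x : Set G) ∨ H.Normal)
    (hy : y ∈ H ⊔ Subgroup.zpowers x) (hyH : y ∉ H) : x ∈ H ⊔ Subgroup.zpowers y := by
  have : ∃ h ∈ H, ∃ z ∈ Subgroup.zpowers x, h * z = y := by
    rcases hn with hn | hn
    · have h2 : Subgroup.zpowers x ≤ Subgroup.normalizer (Subgroup.zpowers x : Set G) :=
        Subgroup.le_normalizer
      rw [← SetLike.mem_coe, Subgroup.coe_mul_of_left_le_normalizer_right _ _ hn] at hy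
      exact hy
    · exact Subgroup.mem_sup_of_normal_left.1 hy
  obtain ⟨h, hh, z, ⟨k, rfl⟩, rfl⟩ := this
  simp only at hyH ⊢
  have hk : x ^ k ≠ 1 := fun h1 => hyH (by rw [h1, mul_one]; exact hh)
  have hxk : x ^ k ∈ H ⊔ Subgroup.zpowers (h * x ^ k) := by
    have := mul_mem (inv_mem (Subgroup.mem_sup_left (T := Subgroup.zpowers (h * x ^ k)) hh))
      (Subgroup.mem_sup_right (S := H) (Subgroup.mem_zpowers (h * x ^ k)))
    simpa using this
  exact Subgroup.zpowers_le.2 hxk (mem_zpowers_of_zpow_ne_one hp hx hk)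

theorem hasExchange_of_elementary_abelian {G : Type*} [Group G] {p : ℕ} (hp : p.Prime)
    (hcomm : ∀ x y : G, x * y = y * x) (hpow : ∀ x : G, x ^ p = 1) : HasExchange G := by
  intro H x y hy hyH
  refine exchange_of_normal hp (hpow x) (Or.inr ⟨fun n hn g => ?_⟩) hy hyH
  rwa [hcomm g n, mul_inv_cancel_right]

theorem hasExchange_of_scalar_action {G : Type*} [Group G] {p q : ℕ} (hp : p.Prime)
    (hq : q.Prime) {P Q : Subgroup G} (hP : P.Normal)
    (hcomm : ∀ x ∈ P, ∀ y ∈ P, x * y = y * x) (hpow : ∀ x ∈ P, x ^ p = 1)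
    (hQ : Nat.card Q = q) (hPQ : P ⊓ Q = ⊥)
    (hmul : ∀ g : G, ∃ x ∈ P, ∃ y ∈ Q, x * y = g)
    (χ : Q →* (ZMod p)ˣ) (hχ : Function.Injective χ)
    (hact : ∀ (y : Q) (x : G), x ∈ P → (y : G) * x * (y : G)⁻¹ = x ^ ((χ y : ZMod p).val)) :
    HasExchange G := by
  have : Fact p.Prime := ⟨hp⟩
  have : Fact q.Prime := ⟨hq⟩
  have hconj : ∀ a ∈ P, ∀ (y : Q), ∀ z ∈ P,
      (a * y) * z * (a * y)⁻¹ = z ^ ((χ y : ZMod p).val) := by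
    intro a ha y z hz
    calc (a * y) * z * (a * y)⁻¹ = a * (y * z * (y : G)⁻¹) * a⁻¹ := by group
      _ = z ^ ((χ y : ZMod p).val) := by
        rw [hact y z hz, hcomm a ha _ (pow_mem hz _), mul_inv_cancel_right]
  have hindex : P.index = q := by
    have hc : Subgroup.IsComplement' P Q := by
      refine Subgroup.isComplement'_of_disjoint_and_mul_eq_univ (disjoint_iff.2 hPQ) ?_
      ext g
      obtain ⟨x, hx, y, hy, rfl⟩ := hmul g
      exact ⟨fun _ => trivial, fun _ => ⟨x, hx, y, hy, rfl⟩⟩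
    rw [← hQ]
    exact hc.symm.index_eq_card
  have hout : ∀ g ∉ P, g ^ q = 1 := by
    intro g hg
    have hz : g ^ q ∈ P := hindex ▸ P.pow_index_mem g
    by_contra hne
    obtain ⟨a, ha, y, hy, rfl⟩ := hmul g
    have h1 := hconj a ha ⟨y, hy⟩ _ hz
    simp only at h1
    have h2 : (a * y) * (a * y) ^ q * (a * y)⁻¹ = (a * y) ^ q := by
      rw [← pow_succ', pow_succ, mul_inv_cancel_right]
    rw [h2] at h1
    have hord : orderOf ((a * y) ^ q) = p := orderOf_eq_prime (hpow _ hz) hne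
    nth_rw 1 [← pow_one ((a * y) ^ q)] at h1
    rw [pow_eq_pow_iff_modEq, hord, ← ZMod.natCast_eq_natCast_iff, ZMod.natCast_zmod_val,
      Nat.cast_one] at h1
    have h3 : (⟨y, hy⟩ : Q) = 1 := hχ (by rw [map_one]; exact Units.ext h1.symm)
    have h4 : y = 1 := congrArg Subtype.val h3
    exact hg (by rw [h4, mul_one]; exact ha)
  have hzp : ∀ x ∈ P, (Subgroup.zpowers x).Normal := by
    intro x hx
    refine ⟨fun n hn g => ?_⟩
    obtain ⟨k, rfl⟩ := hn
    obtain ⟨a, ha, y, hy, rfl⟩ := hmul g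
    rw [hconj a ha ⟨y, hy⟩ _ (zpow_mem hx k)]
    exact pow_mem (zpow_mem (Subgroup.mem_zpowers x) k) _
  have hin : ∀ (H : Subgroup G), ∀ x ∈ P, ∀ y, y ∈ H ⊔ Subgroup.zpowers x → y ∉ H →
      x ∈ H ⊔ Subgroup.zpowers y := by
    intro H x hx y hy hyH
    refine exchange_of_normal hp (hpow x hx) (Or.inl ?_) hy hyH
    have := hzp x hx
    rw [Subgroup.normalizer_eq_top]
    exact le_top
  intro H x y hy hyH
  by_cases hx : x ∈ P
  · exact hin H x hx y hy hyH
  by_cases hHP : H ≤ P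
  · refine exchange_of_normal hq (hout x hx) (Or.inr ⟨fun n hn g => ?_⟩) hy hyH
    exact Subgroup.zpowers_le.2 hn ((hzp n (hHP hn)).conj_mem n (Subgroup.mem_zpowers n) g)
  · obtain ⟨h, hh, hhP⟩ := Set.not_subset.1 hHP
    have hcard : Nat.card (G ⧸ P) = q := hindex
    have hmem : (x : G ⧸ P) ∈ Subgroup.zpowers (h : G ⧸ P) :=
      mem_zpowers_of_prime_card hcard (fun h1 => hhP ((QuotientGroup.eq_one_iff h).1 h1))
    obtain ⟨j, hj⟩ := hmem
    have hx' : x * (h ^ j)⁻¹ ∈ P := by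
      rw [← QuotientGroup.eq_one_iff, QuotientGroup.mk_mul, QuotientGroup.mk_inv,
        QuotientGroup.mk_zpow, ← hj]
      exact mul_inv_cancel _
    have hhj : h ^ j ∈ H := zpow_mem hh j
    have hy' : y ∈ H ⊔ Subgroup.zpowers (x * (h ^ j)⁻¹) := by
      refine sup_le le_sup_left (Subgroup.zpowers_le.2 ?_) hy
      have := mul_mem (Subgroup.mem_sup_right (S := H) (Subgroup.mem_zpowers (x * (h ^ j)⁻¹)))
        (Subgroup.mem_sup_left (T := Subgroup.zpowers (x * (h ^ j)⁻¹)) hhj)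
      simpa using this
    have := mul_mem (hin H _ hx' y hy' hyH)
      (Subgroup.mem_sup_left (T := Subgroup.zpowers y) hhj)
    simpa using this

/-! ### Consequences of being a matroid group -/

/-- In a matroid group, no independent set is larger than
a set generating a group that contains it. -/
theorem IsMatroidGroup.ncard_le {G : Type*} [Group G] [Finite G] (hG : IsMatroidGroup G)
    {A B : Set G} (hA : IsIndepSet A) (hAB : A ⊆ Subgroup.closure B) : A.ncard ≤ B.ncard := by
  obtain ⟨Z, hAZ, hZ⟩ := hG.2 A hA
  have hgen : Subgroup.closure (B ∪ (Z \ A)) = ⊤ := by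
    rw [eq_top_iff, ← hZ.1, Subgroup.closure_le]
    intro z hz
    by_cases hzA : z ∈ A
    · exact Subgroup.closure_mono Set.subset_union_left (hAB hzA)
    · exact Subgroup.subset_closure (Or.inr ⟨hz, hzA⟩)
  obtain ⟨Y, hYB, hY, hcl⟩ := exists_indep_subset_closure_eq (B ∪ (Z \ A))
  have h1 := hG.1 Z Y hZ (isMinimalGenSet_iff.2 ⟨hcl.trans hgen, hY⟩)
  have h2 := Set.ncard_le_ncard hYB (Set.toFinite _)
  have h3 := Set.ncard_union_le B (Z \ A)
  have h4 := Set.ncard_sdiff_add_ncard_of_subset hAZ (Set.toFinite _)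
  omega

/-- Of two commuting elements of coprime prime-power orders, one is trivial; for finite groups
this says that every element has prime-power order. -/
def HasPrimePowerOrders (G : Type*) [Group G] : Prop :=
  ∀ ⦃p r : ℕ⦄, p.Prime → r.Prime → p ≠ r → ∀ (x y : G) (i j : ℕ), Commute x y →
    x ^ p ^ i = 1 → y ^ r ^ j = 1 → x = 1 ∨ y = 1

/-- Of any three elements, one lies in the subgroup generated by the other two. -/
def TriplesDependent (G : Type*) [Group G] : Prop :=
  ∀ a b c : G, a ∈ Subgroup.closure {b, c} ∨ b ∈ Subgroup.closure {a, c} ∨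
    c ∈ Subgroup.closure {a, b}

theorem eq_one_of_pow_coprime {G : Type*} [Group G] {x : G} {m n : ℕ} (h : m.Coprime n)
    (hm : x ^ m = 1) (hn : x ^ n = 1) : x = 1 := by
  have := pow_gcd_eq_one.2 ⟨hm, hn⟩
  rwa [h.gcd_eq_one, pow_one] at this

theorem eq_one_of_pow_prime_pow {G : Type*} [Group G] {x : G} {p r : ℕ} (hp : p.Prime)
    (hr : r.Prime) (hpr : p ≠ r) {i j : ℕ} (hi : x ^ p ^ i = 1) (hj : x ^ r ^ j = 1) : x = 1 :=
  eq_one_of_pow_coprime (((Nat.coprime_primes hp hr).2 hpr).pow i j) hi hj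

theorem pow_eq_one_of_mem_zpowers {G : Type*} [Group G] {x y : G} {n : ℕ}
    (hy : y ^ n = 1) (hx : x ∈ Subgroup.zpowers y) : x ^ n = 1 := by
  obtain ⟨k, rfl⟩ := hx
  change (y ^ k) ^ n = 1
  rw [← zpow_natCast, ← zpow_mul, mul_comm, zpow_mul, zpow_natCast, hy, one_zpow]

/-- A power that is trivial modulo a subgroup, with exponent coprime to the order. -/
theorem mem_of_pow_coprime_mem {G : Type*} [Group G] {H : Subgroup G} {x : G} {m n : ℕ}
    (h : m.Coprime n) (hm : x ^ m ∈ H) (hn : x ^ n ∈ H) : x ∈ H := by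
  have hcop : IsCoprime (m : ℤ) (n : ℤ) := Nat.isCoprime_iff_coprime.2 h
  obtain ⟨a, b, hab⟩ := hcop
  have : x = (x ^ m) ^ a * (x ^ n) ^ b := by
    rw [← zpow_natCast, ← zpow_natCast, ← zpow_mul, ← zpow_mul, ← zpow_add, mul_comm _ a,
      mul_comm _ b, hab, zpow_one]
  rw [this]
  exact mul_mem (zpow_mem hm a) (zpow_mem hn b)

theorem mem_zpowers_mul_of_coprime {G : Type*} [Group G] {x y : G} {m n : ℕ} (h : m.Coprime n)
    (hxy : Commute x y) (hm : x ^ m = 1) (hn : y ^ n = 1) : x ∈ Subgroup.zpowers (x * y) := by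
  have hxn : x ^ n ∈ Subgroup.zpowers (x * y) :=
    ⟨n, by simp only [zpow_natCast]; rw [hxy.mul_pow, hn, mul_one]⟩
  exact mem_of_pow_coprime_mem h (hm ▸ one_mem _) hxn

theorem IsMatroidGroup.hasPrimePowerOrders {G : Type*} [Group G] [Finite G]
    (hG : IsMatroidGroup G) : HasPrimePowerOrders G := by
  intro p r hp hr hpr x y i j hxy hx hy
  by_contra! hne
  have hcop : (p ^ i).Coprime (r ^ j) := ((Nat.coprime_primes hp hr).2 hpr).pow i j
  have hxny : x ∉ Subgroup.zpowers y := fun h =>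
    hne.1 (eq_one_of_pow_coprime hcop hx (pow_eq_one_of_mem_zpowers hy h))
  have hynx : y ∉ Subgroup.zpowers x := fun h =>
    hne.2 (eq_one_of_pow_coprime hcop (pow_eq_one_of_mem_zpowers hx h) hy)
  have hne' : x ≠ y := fun h => hxny (h ▸ Subgroup.mem_zpowers x)
  have hind : IsIndepSet ({x, y} : Set G) := by
    rw [isIndepSet_iff]
    rintro z (rfl | rfl)
    · rwa [Set.pair_sdiff_left hne', ← Subgroup.zpowers_eq_closure]
    · rwa [Set.pair_sdiff_right hne', ← Subgroup.zpowers_eq_closure]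
  have := hG.ncard_le (B := {x * y}) hind (by
    rintro z (rfl | rfl)
    · rw [← Subgroup.zpowers_eq_closure]
      exact mem_zpowers_mul_of_coprime hcop hxy hx hy
    · rw [← Subgroup.zpowers_eq_closure, hxy.eq]
      exact mem_zpowers_mul_of_coprime hcop.symm hxy.symm hy hx)
  rw [Set.ncard_pair hne', Set.ncard_singleton] at this
  omega

theorem IsMatroidGroup.dependent {G : Type*} [Group G] [Finite G] (hG : IsMatroidGroup G)
    {x y a b c : G} (ha : a ∈ Subgroup.closure {x, y}) (hb : b ∈ Subgroup.closure {x, y})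
    (hc : c ∈ Subgroup.closure {x, y}) :
    a ∈ Subgroup.closure {b, c} ∨ b ∈ Subgroup.closure {a, c} ∨ c ∈ Subgroup.closure {a, b} := by
  by_contra! h
  obtain ⟨h1, h2, h3⟩ := h
  have hab : a ≠ b := fun h => h1 (Subgroup.subset_closure (Or.inl h))
  have hac : a ≠ c := fun h => h1 (Subgroup.subset_closure (Or.inr h))
  have hbc : b ≠ c := fun h => h2 (Subgroup.subset_closure (Or.inr h))
  have hind : IsIndepSet ({a, b, c} : Set G) := by
    rw [isIndepSet_iff]
    rintro z (rfl | rfl | rfl) hz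
    · refine h1 (Subgroup.closure_mono ?_ hz)
      rintro w ⟨rfl | hw, hwz⟩
      · exact absurd rfl hwz
      · exact hw
    · refine h2 (Subgroup.closure_mono ?_ hz)
      rintro w ⟨rfl | rfl | rfl, hwz⟩
      · exact Or.inl rfl
      · exact absurd rfl hwz
      · exact Or.inr rfl
    · refine h3 (Subgroup.closure_mono ?_ hz)
      rintro w ⟨rfl | rfl | rfl, hwz⟩
      · exact Or.inl rfl
      · exact Or.inr rfl
      · exact absurd rfl hwz
  have := hG.ncard_le (B := {x, y}) hind (by
    rintro z (rfl | rfl | rfl) <;> assumption)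
  have h4 : ({x, y} : Set G).ncard ≤ 2 := Set.ncard_insert_le x {y} |>.trans (by simp)
  rw [Set.ncard_insert_of_notMem (by simp [hab, hac]), Set.ncard_pair hbc] at this
  omega

theorem mem_closure_pair_map {G K : Type*} [Group G] [Group K] (f : G →* K) {a b c : G}
    (h : a ∈ Subgroup.closure {b, c}) : f a ∈ Subgroup.closure {f b, f c} := by
  have := Subgroup.mem_map_of_mem f h
  rwa [MonoidHom.map_closure, Set.image_pair] at this

theorem mem_closure_pair_of_injective {G K : Type*} [Group G] [Group K] {f : G →* K}
    (hf : Function.Injective f) {a b c : G} (h : f a ∈ Subgroup.closure {f b, f c}) :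
    a ∈ Subgroup.closure {b, c} := by
  rw [← Set.image_pair, ← MonoidHom.map_closure] at h
  exact (Subgroup.mem_map_iff_mem hf).1 h

theorem HasPrimePowerOrders.of_injective {G K : Type*} [Group G] [Group K]
    (hK : HasPrimePowerOrders K) {f : G →* K} (hf : Function.Injective f) :
    HasPrimePowerOrders G := by
  intro p r hp hr hpr x y i j hxy hx hy
  have := hK hp hr hpr (f x) (f y) i j (hxy.map f) (by rw [← map_pow, hx, map_one])
    (by rw [← map_pow, hy, map_one])
  exact this.imp (fun h => hf (h.trans f.map_one.symm)) (fun h => hf (h.trans f.map_one.symm))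

theorem HasPrimePowerOrders.subgroup {G : Type*} [Group G] (hG : HasPrimePowerOrders G)
    (H : Subgroup G) : HasPrimePowerOrders H := hG.of_injective H.subtype_injective

theorem TriplesDependent.subgroup {G : Type*} [Group G] (hG : TriplesDependent G)
    (H : Subgroup G) : TriplesDependent H := by
  intro a b c
  have hf := H.subtype_injective
  exact (hG a b c).imp (mem_closure_pair_of_injective hf)
    (Or.imp (mem_closure_pair_of_injective hf) (mem_closure_pair_of_injective hf))

theorem TriplesDependent.of_surjective {G K : Type*} [Group G] [Group K]
    (hG : TriplesDependent G) {f : G →* K} (hf : Function.Surjective f) :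
    TriplesDependent K := by
  intro a b c
  obtain ⟨a, rfl⟩ := hf a
  obtain ⟨b, rfl⟩ := hf b
  obtain ⟨c, rfl⟩ := hf c
  exact (hG a b c).imp (mem_closure_pair_map f)
    (Or.imp (mem_closure_pair_map f) (mem_closure_pair_map f))

theorem IsMatroidGroup.triplesDependent {G : Type*} [Group G] [Finite G]
    (hG : IsMatroidGroup G) (x y : G) : TriplesDependent (Subgroup.closure {x, y}) := by
  intro a b c
  have hf := (Subgroup.closure {x, y}).subtype_injective
  exact (hG.dependent a.2 b.2 c.2).imp (mem_closure_pair_of_injective hf)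
    (Or.imp (mem_closure_pair_of_injective hf) (mem_closure_pair_of_injective hf))

theorem HasPrimePowerOrders.exists_pow_eq_one {G : Type*} [Group G] [Finite G]
    (hG : HasPrimePowerOrders G) (g : G) : ∃ p : ℕ, p.Prime ∧ ∃ k : ℕ, g ^ p ^ k = 1 := by
  by_cases h1 : g = 1
  · exact ⟨2, Nat.prime_two, 0, by simp [h1]⟩
  have hpos : orderOf g ≠ 0 := (orderOf_pos g).ne'
  obtain ⟨p, hp, hdvd⟩ := Nat.exists_prime_and_dvd (n := orderOf g)
    (by rwa [Ne, orderOf_eq_one_iff])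
  obtain ⟨k, m, hm, hk⟩ := Nat.exists_eq_pow_mul_and_not_dvd hpos p hp.ne_one
  refine ⟨p, hp, k, ?_⟩
  by_contra hne
  have hm1 : m ≠ 1 := fun h => hne (by
    have := pow_orderOf_eq_one g
    rwa [hk, h, mul_one] at this)
  obtain ⟨r, hr, hrm⟩ := Nat.exists_prime_and_dvd hm1
  have hpr : p ≠ r := fun h => hm (h ▸ hrm)
  have hord1 : orderOf (g ^ (orderOf g / p)) = p := orderOf_pow_orderOf_div hpos hdvd
  have hdvd2 : r ∣ orderOf g := hk ▸ hrm.mul_left _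
  have hord2 : orderOf (g ^ (orderOf g / r)) = r := orderOf_pow_orderOf_div hpos hdvd2
  rcases hG hp hr hpr (g ^ (orderOf g / p)) (g ^ (orderOf g / r)) 1 1
    ((Commute.refl g).pow_pow _ _) (by rw [pow_one]; exact orderOf_dvd_iff_pow_eq_one.1 hord1.dvd)
    (by rw [pow_one]; exact orderOf_dvd_iff_pow_eq_one.1 hord2.dvd) with h | h
  · rw [h, orderOf_one] at hord1; exact hp.one_lt.ne hord1
  · rw [h, orderOf_one] at hord2; exact hr.one_lt.ne hord2

theorem HasPrimePowerOrders.of_surjective {G K : Type*} [Group G] [Finite G] [Group K]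
    (hG : HasPrimePowerOrders G) {f : G →* K} (hf : Function.Surjective f) :
    HasPrimePowerOrders K := by
  intro p r hp hr hpr x y i j hxy hx hy
  have hcop : (p ^ i).Coprime (r ^ j) := ((Nat.coprime_primes hp hr).2 hpr).pow i j
  obtain ⟨g, hg⟩ := hf (x * y)
  obtain ⟨t, ht, k, hk⟩ := hG.exists_pow_eq_one g
  have hxy' : (x * y) ^ t ^ k = 1 := by rw [← hg, ← map_pow, hk, map_one]
  by_cases htp : t = p
  · right
    have := pow_eq_one_of_mem_zpowers hxy'
      (hxy.eq ▸ mem_zpowers_mul_of_coprime hcop.symm hxy.symm hy hx)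
    exact eq_one_of_pow_prime_pow ht hr (htp ▸ hpr) this hy
  · left
    have := pow_eq_one_of_mem_zpowers hxy' (mem_zpowers_mul_of_coprime hcop hxy hx hy)
    exact eq_one_of_pow_prime_pow ht hp htp this hx

/-! ### Extensions of primary groups by primary groups -/

theorem isPGroup_subgroup_iff {G : Type*} [Group G] {p : ℕ} {H : Subgroup G} :
    IsPGroup p H ↔ ∀ x ∈ H, ∃ k : ℕ, x ^ p ^ k = 1 := by
  constructor
  · intro h x hx
    obtain ⟨k, hk⟩ := h ⟨x, hx⟩
    exact ⟨k, by simpa using congrArg Subtype.val hk⟩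
  · rintro h ⟨x, hx⟩
    obtain ⟨k, hk⟩ := h x hx
    exact ⟨k, Subtype.ext (by simpa using hk)⟩

/-- A group with a normal `p`-subgroup whose quotient is a `q`-group, for distinct primes
`p` and `q`. -/
def IsPrimaryByPrimary (K : Type*) [Group K] : Prop :=
  ∃ p q : ℕ, p.Prime ∧ q.Prime ∧ p ≠ q ∧ ∃ P : Subgroup K, P.Normal ∧ IsPGroup p P ∧
    ∀ g : K, ∃ k : ℕ, g ^ q ^ k ∈ P

theorem exists_prime_ne (p : ℕ) : ∃ q : ℕ, q.Prime ∧ p ≠ q := by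
  obtain ⟨q, hq, hq'⟩ := Nat.exists_infinite_primes (p + 1)
  exact ⟨q, hq', by omega⟩

theorem IsPGroup.isPrimaryByPrimary {K : Type*} [Group K] {p : ℕ} (hp : p.Prime)
    (h : IsPGroup p K) : IsPrimaryByPrimary K := by
  obtain ⟨q, hq, hpq⟩ := exists_prime_ne p
  exact ⟨p, q, hp, hq, hpq, ⊤, inferInstance, h.to_subgroup _, fun g => ⟨0, trivial⟩⟩

theorem mem_of_pow_prime_pow_mem {K : Type*} [Group K] {p q : ℕ} (hp : p.Prime) (hq : q.Prime)
    (hpq : p ≠ q) {P : Subgroup K} {x : K} {i j : ℕ} (hi : x ^ p ^ i ∈ P) (hj : x ^ q ^ j ∈ P) :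
    x ∈ P :=
  mem_of_pow_coprime_mem (((Nat.coprime_primes hp hq).2 hpq).pow i j) hi hj

theorem disjoint_of_isPGroup_ne {K : Type*} [Group K] {p q : ℕ} (hp : p.Prime) (hq : q.Prime)
    (hpq : p ≠ q) {P Q : Subgroup K} (hP : IsPGroup p P) (hQ : IsPGroup q Q) {x : K}
    (hxP : x ∈ P) (hxQ : x ∈ Q) : x = 1 := by
  obtain ⟨i, hi⟩ := isPGroup_subgroup_iff.1 hP x hxP
  obtain ⟨j, hj⟩ := isPGroup_subgroup_iff.1 hQ x hxQ
  exact eq_one_of_pow_prime_pow hp hq hpq hi hj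

/-- In a group with prime-power element orders, subgroups for different primes that normalize
each other cannot both be nontrivial. -/
theorem HasPrimePowerOrders.eq_one_of_normalize {K : Type*} [Group K]
    (hK : HasPrimePowerOrders K) {p r : ℕ} (hp : p.Prime) (hr : r.Prime) (hpr : p ≠ r)
    {V R : Subgroup K} (hV : IsPGroup p V) (hR : IsPGroup r R) {v ρ : K} (hv : v ∈ V) (hρ : ρ ∈ R)
    (hvR : v * ρ * v⁻¹ ∈ R) (hρV : ρ * v⁻¹ * ρ⁻¹ ∈ V) : v = 1 ∨ ρ = 1 := by
  have h1 : v * ρ * v⁻¹ * ρ⁻¹ = 1 := by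
    refine disjoint_of_isPGroup_ne hp hr hpr hV hR ?_ (mul_mem hvR (inv_mem hρ))
    rw [mul_assoc, mul_assoc, ← mul_assoc ρ]
    exact mul_mem hv hρV
  have hcomm : Commute v ρ := mul_inv_eq_iff_eq_mul.1 (mul_inv_eq_one.1 h1)
  obtain ⟨i, hi⟩ := isPGroup_subgroup_iff.1 hV v hv
  obtain ⟨j, hj⟩ := isPGroup_subgroup_iff.1 hR ρ hρ
  exact hK hp hr hpr v ρ i j hcomm hi hj

theorem exists_mem_ne_one {K : Type*} [Group K] {V : Subgroup K} (h : V ≠ ⊥) :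
    ∃ v ∈ V, v ≠ 1 := by
  by_contra! hcon
  exact h ((Subgroup.eq_bot_iff_forall V).2 hcon)

theorem IsPrimaryByPrimary.exists_of_normal {K : Type*} [Group K] (hS : IsPrimaryByPrimary K)
    (hK : HasPrimePowerOrders K) {r : ℕ} (hr : r.Prime) {Y : Subgroup K} (hYn : Y.Normal)
    (hY : IsPGroup r Y) (hY1 : Y ≠ ⊥) :
    ∃ R : Subgroup K, R.Normal ∧ IsPGroup r R ∧ ∃ s : ℕ, s.Prime ∧ s ≠ r ∧
      ∀ g : K, ∃ k : ℕ, g ^ s ^ k ∈ R := by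
  obtain ⟨p, q, hp, hq, hpq, P, hPn, hP, hg⟩ := hS
  by_cases hrp : p = r
  · subst hrp
    exact ⟨P, hPn, hP, q, hq, hpq.symm, hg⟩
  · obtain ⟨y, hyY, hy1⟩ := exists_mem_ne_one hY1
    have hPbot : ∀ x ∈ P, x = 1 := fun x hx =>
      (hK.eq_one_of_normalize hp hr hrp hP hY hx hyY (hYn.conj_mem _ hyY _)
        (hPn.conj_mem _ (inv_mem hx) _)).resolve_right hy1
    have hq1 : ∀ g : K, ∃ k : ℕ, g ^ q ^ k = 1 := fun g => (hg g).imp fun k hk => hPbot _ hk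
    have hrq : q = r := by
      by_contra hne
      obtain ⟨i, hi⟩ := hq1 y
      obtain ⟨j, hj⟩ := isPGroup_subgroup_iff.1 hY y hyY
      exact hy1 (eq_one_of_pow_prime_pow hq hr hne hi hj)
    subst hrq
    exact ⟨⊤, inferInstance, isPGroup_subgroup_iff.2 fun x _ => hq1 x, p, hp, hrp,
      fun g => ⟨0, trivial⟩⟩

theorem closure_pair_le_sup_zpowers {K : Type*} [Group K] {V : Subgroup K} {v h : K} (hv : v ∈ V) :
    Subgroup.closure {v, h} ≤ V ⊔ Subgroup.zpowers h := by
  rw [Subgroup.closure_le]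
  rintro z (rfl | rfl)
  · exact Subgroup.mem_sup_left hv
  · exact Subgroup.mem_sup_right (Subgroup.mem_zpowers _)

theorem exists_mul_zpow_of_mem_sup {K : Type*} [Group K] {V : Subgroup K} {h x : K}
    (hh : h ∈ Subgroup.normalizer (V : Set K)) (hx : x ∈ V ⊔ Subgroup.zpowers h) :
    ∃ v ∈ V, ∃ j : ℤ, v * h ^ j = x := by
  rw [← SetLike.mem_coe, Subgroup.coe_mul_of_right_le_normalizer_left _ _
    (Subgroup.zpowers_le.2 hh)] at hx
  obtain ⟨v, hv, _, ⟨j, rfl⟩, hj⟩ := hx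
  exact ⟨v, hv, j, hj⟩

theorem le_sup_of_pow_mem {K : Type*} [Group K] [Finite K] {r : ℕ} [Fact r.Prime]
    {V P : Subgroup K} [V.Normal] (hPV : ∀ x ∈ P, ∃ k : ℕ, x ^ r ^ k ∈ V) (R : Sylow r P) :
    P ≤ V ⊔ (R : Subgroup P).map P.subtype := by
  set R' := (R : Subgroup P).map P.subtype
  have h1 : (V ⊔ R').relIndex P ∣ V.relIndex P := Subgroup.relIndex_dvd_of_le_left _ le_sup_left
  have h2 : (V ⊔ R').relIndex P ∣ R'.relIndex P := Subgroup.relIndex_dvd_of_le_left _ le_sup_right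
  have h3 : ¬ r ∣ R'.relIndex P := by
    have : R'.relIndex P = (R : Subgroup P).index := by
      rw [Subgroup.relIndex, Subgroup.subgroupOf, Subgroup.comap_map_eq_self_of_injective
        P.subtype_injective]
    rw [this]
    exact R.not_dvd_index
  have h4 : IsPGroup r (P ⧸ V.subgroupOf P) := by
    intro x
    obtain ⟨x, rfl⟩ := QuotientGroup.mk_surjective x
    obtain ⟨k, hk⟩ := hPV x x.2
    refine ⟨k, ?_⟩
    rw [← QuotientGroup.mk_pow, QuotientGroup.eq_one_iff, Subgroup.mem_subgroupOf]
    simpa using hk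
  obtain ⟨n, hn⟩ := IsPGroup.iff_card.1 h4
  have h5 : V.relIndex P = r ^ n := hn
  rw [← Subgroup.relIndex_eq_one]
  rw [h5] at h1
  obtain ⟨m, -, hm⟩ := (Nat.dvd_prime_pow Fact.out).1 h1
  rcases Nat.eq_zero_or_pos m with rfl | hm0
  · rw [hm, pow_zero]
  · exact absurd ((dvd_pow_self r hm0.ne').trans (hm ▸ h2)) h3

theorem isPrimaryByPrimary_of_quotient {K : Type*} [Group K] [Finite K]
    (hK : HasPrimePowerOrders K) (hD : TriplesDependent K) {p : ℕ} (hp : p.Prime)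
    {V : Subgroup K} [hVn : V.Normal] (hV : IsPGroup p V) (hV1 : V ≠ ⊥)
    (hS : IsPrimaryByPrimary (K ⧸ V)) : IsPrimaryByPrimary K := by
  obtain ⟨r, q, hr, hq, hrq, P', hPn', hP', hg'⟩ := hS
  set P : Subgroup K := P'.comap (QuotientGroup.mk' V) with hPdef
  have hPn : P.Normal := hPn'.comap _
  have hVP : V ≤ P := by
    intro v hv
    rw [hPdef, Subgroup.mem_comap, QuotientGroup.mk'_apply, (QuotientGroup.eq_one_iff v).2 hv]
    exact one_mem _
  have hPV : ∀ x ∈ P, ∃ k : ℕ, x ^ r ^ k ∈ V := by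
    intro x hx
    obtain ⟨k, hk⟩ := isPGroup_subgroup_iff.1 hP' _ hx
    exact ⟨k, (QuotientGroup.eq_one_iff _).1 (by simpa using hk)⟩
  have hg : ∀ g : K, ∃ k : ℕ, g ^ q ^ k ∈ P := by
    intro g
    obtain ⟨k, hk⟩ := hg' (g : K ⧸ V)
    exact ⟨k, by simpa [hPdef] using hk⟩
  have hVpow : ∀ x : K, ∀ n : ℕ, x ^ n ∈ V → ∃ k : ℕ, (x ^ n) ^ p ^ k = 1 :=
    fun x n hx => isPGroup_subgroup_iff.1 hV _ hx
  have hconcl : ∀ t : ℕ, t.Prime → (∀ g : K, ∃ k : ℕ, g ^ t ^ k ∈ V) → IsPrimaryByPrimary K := by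
    intro t ht h
    by_cases htp : p = t
    · refine IsPGroup.isPrimaryByPrimary hp fun g => ?_
      obtain ⟨k, hk⟩ := h g
      obtain ⟨l, hl⟩ := hVpow _ _ hk
      exact ⟨k + l, by rw [pow_add, pow_mul]; rwa [← htp] at hl⟩
    · exact ⟨p, t, hp, ht, htp, V, hVn, hV, h⟩
  by_cases hrp : r = p
  · subst hrp
    refine ⟨r, q, hp, hq, hrq, P, hPn, isPGroup_subgroup_iff.2 fun x hx => ?_, hg⟩
    obtain ⟨k, hk⟩ := hPV x hx
    obtain ⟨l, hl⟩ := hVpow _ _ hk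
    exact ⟨k + l, by rw [pow_add, pow_mul, hl]⟩
  by_cases hPleV : P ≤ V
  · exact hconcl q hq fun g => (hg g).imp fun k hk => hPleV hk
  by_cases hall : ∀ g : K, ∃ k : ℕ, g ^ r ^ k ∈ V
  · exact hconcl r hr hall
  exfalso
  push Not at hall
  obtain ⟨g, hgr⟩ := hall
  have : Fact r.Prime := ⟨hr⟩
  obtain ⟨R⟩ : Nonempty (Sylow r P) := inferInstance
  set R' := (R : Subgroup P).map P.subtype with hR'def
  have hR' : IsPGroup r R' := R.2.map _
  have hPle := le_sup_of_pow_mem hPV R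
  have hR1 : R' ≠ ⊥ := by
    intro h
    rw [← hR'def, h, sup_bot_eq] at hPle
    exact hPleV hPle
  set H := Subgroup.normalizer (R' : Set K) with hHdef
  have hR'H : R' ≤ H := Subgroup.le_normalizer
  have htop : V ⊔ H = ⊤ := by
    rw [eq_top_iff, ← Sylow.normalizer_sup_eq_top R]
    refine sup_le le_sup_right (hPle.trans (sup_le le_sup_left (hR'H.trans le_sup_right)))
  obtain ⟨ρ, hρ, hρ1⟩ := exists_mem_ne_one hR1
  have hVH : ∀ x ∈ V, x ∈ H → x = 1 := by
    intro x hxV hxH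
    exact (hK.eq_one_of_normalize hp hr (Ne.symm hrp) hV hR' hxV hρ
      ((Subgroup.mem_normalizer_iff.1 hxH ρ).1 hρ)
      (hVn.conj_mem _ (inv_mem hxV) _)).resolve_right hρ1
  obtain ⟨v, hv, hv1⟩ := exists_mem_ne_one hV1
  obtain ⟨w, hw, h, hh, rfl⟩ := Subgroup.mem_sup_of_normal_left.1 (htop ▸ Subgroup.mem_top g :
    g ∈ V ⊔ H)
  have hhr : ∀ k : ℕ, h ^ r ^ k ≠ 1 := by
    intro k hk
    refine hgr k ?_
    rw [← QuotientGroup.eq_one_iff, QuotientGroup.mk_pow, QuotientGroup.mk_mul,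
      (QuotientGroup.eq_one_iff w).2 hw, one_mul, ← QuotientGroup.mk_pow, hk, QuotientGroup.mk_one]
  have hnV : ∀ x : K, x ∈ Subgroup.normalizer (V : Set K) := by
    intro x; rw [Subgroup.normalizer_eq_top]; trivial
  have hmem : ∀ x ∈ H, ∀ y ∈ H, x ∈ Subgroup.closure {v, y} → x ∈ Subgroup.zpowers y := by
    intro x hx y hy hxy
    obtain ⟨u, hu, j, rfl⟩ := exists_mul_zpow_of_mem_sup (hnV y)
      (closure_pair_le_sup_zpowers hv hxy)
    have : u ∈ H := by
      have := mul_mem hx (inv_mem (zpow_mem hy j))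
      rwa [mul_inv_cancel_right] at this
    rw [hVH u hu this, one_mul]
    exact zpow_mem (Subgroup.mem_zpowers y) j
  rcases hD v ρ h with h1 | h1 | h1
  · refine hv1 (hVH v hv ?_)
    refine (Subgroup.closure_le H).2 ?_ h1
    rintro z (rfl | rfl)
    · exact hR'H hρ
    · exact hh
  · obtain ⟨t, ht, k, hk⟩ := hK.exists_pow_eq_one h
    obtain ⟨i, hi⟩ := isPGroup_subgroup_iff.1 hR' ρ hρ
    have htr : t ≠ r := fun htr => hhr k (htr ▸ hk)
    exact hρ1 (eq_one_of_pow_prime_pow ht hr htr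
      (pow_eq_one_of_mem_zpowers hk (hmem ρ (hR'H hρ) h hh h1)) hi)
  · obtain ⟨i, hi⟩ := isPGroup_subgroup_iff.1 hR' ρ hρ
    exact hhr i (pow_eq_one_of_mem_zpowers hi (hmem h hh ρ (hR'H hρ) h1))

/-! ### Fixed points and primes acting on primary groups -/

theorem card_modEq_one_of_fixedPointFree {K : Type*} [Group K] [Finite K] {W : Subgroup K} {c : K}
    {s : ℕ} (hs : s.Prime) (hc : c ^ s = 1) (hcW : ∀ x ∈ W, c * x * c⁻¹ ∈ W)
    (hfix : ∀ x ∈ W, c * x * c⁻¹ = x → x = 1) : Nat.card W ≡ 1 [MOD s] := by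
  classical
  have : Fact s.Prime := ⟨hs⟩
  have := Fintype.ofFinite W
  let f : Function.End W := fun x => ⟨c * x * c⁻¹, hcW x x.2⟩
  have hiter : ∀ (n : ℕ) (x : W),
      (((f ^ n : Function.End W) x : W) : K) = c ^ n * x * (c ^ n)⁻¹ := by
    intro n
    induction n with
    | zero => intro x; simp [show (1 : Function.End W) x = x from rfl]
    | succ n ih =>
      intro x
      have : (f ^ (n + 1) : Function.End W) x = f ((f ^ n : Function.End W) x) := by
        rw [pow_succ']; rfl
      rw [this]
      change c * ((f ^ n : Function.End W) x : K) * c⁻¹ = _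
      rw [ih, pow_succ']
      group
  have hf : f ^ s ^ 1 = 1 := by
    funext x
    apply Subtype.ext
    rw [hiter, pow_one, hc]
    simp [show (1 : Function.End W) x = x from rfl]
  have h := Equiv.Perm.card_fixedPoints_modEq hf
  have h1 : Fintype.card (Function.fixedPoints f) = 1 := by
    rw [Fintype.card_eq_one_iff]
    refine ⟨⟨1, Subtype.ext (by simp [f])⟩, ?_⟩
    rintro ⟨x, hx⟩
    have hx' : f x = x := hx
    exact Subtype.ext (Subtype.ext (hfix x x.2 (congrArg Subtype.val hx')))
  rw [h1] at h
  rwa [Nat.card_eq_fintype_card]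

/-- The elements of order dividing `r` in the center of a subgroup. -/
def omegaCenter {K : Type*} [Group K] (r : ℕ) (R : Subgroup K) : Subgroup K where
  carrier := {x | x ∈ R ∧ (∀ y ∈ R, Commute x y) ∧ x ^ r = 1}
  mul_mem' := by
    rintro a b ⟨ha, ha', ha''⟩ ⟨hb, hb', hb''⟩
    exact ⟨mul_mem ha hb, fun y hy => (ha' y hy).mul_left (hb' y hy), by
      rw [(ha' b hb).mul_pow, ha'', hb'', one_mul]⟩
  one_mem' := ⟨one_mem _, fun y _ => Commute.one_left y, one_pow _⟩
  inv_mem' := by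
    rintro a ⟨ha, ha', ha''⟩
    exact ⟨inv_mem ha, fun y hy => (ha' y hy).inv_left, by rw [inv_pow, ha'', inv_one]⟩

theorem omegaCenter_le {K : Type*} [Group K] {r : ℕ} {R : Subgroup K} : omegaCenter r R ≤ R :=
  fun _ h => h.1

theorem isPGroup_omegaCenter {K : Type*} [Group K] {r : ℕ} {R : Subgroup K} :
    IsPGroup r (omegaCenter r R) :=
  isPGroup_subgroup_iff.2 fun x hx => ⟨1, by rw [pow_one]; exact hx.2.2⟩

theorem conj_mem_omegaCenter {K : Type*} [Group K] {r : ℕ} {R : Subgroup K} {c x : K}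
    (hc : c ∈ Subgroup.normalizer (R : Set K)) (hx : x ∈ omegaCenter r R) :
    c * x * c⁻¹ ∈ omegaCenter r R := by
  refine ⟨(Subgroup.mem_normalizer_iff.1 hc x).1 hx.1, fun y hy => ?_, ?_⟩
  · have h1 := (Subgroup.mem_normalizer_iff.1 (inv_mem hc) y).1 hy
    rw [inv_inv] at h1
    have := (hx.2.1 _ h1).map (MulAut.conj c)
    simpa [mul_assoc] using this
  · rw [conj_pow, hx.2.2, mul_one, mul_inv_cancel]

theorem omegaCenter_ne_bot {K : Type*} [Group K] [Finite K] {r : ℕ} (hr : r.Prime)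
    {R : Subgroup K} (hR : IsPGroup r R) (hR1 : R ≠ ⊥) : omegaCenter r R ≠ ⊥ := by
  have : Fact r.Prime := ⟨hr⟩
  have : Nontrivial R := (Subgroup.nontrivial_iff_ne_bot R).2 hR1
  have hZ := hR.center_nontrivial
  have hZp : IsPGroup r (Subgroup.center R) := hR.to_subgroup _
  obtain ⟨n, hn, hcard⟩ := hZp.nontrivial_iff_card.1 hZ
  obtain ⟨z, hz⟩ := exists_prime_orderOf_dvd_card' (G := Subgroup.center R) r
    (hcard ▸ dvd_pow_self r hn.ne')
  intro hbot
  have hmem : ((z : R) : K) ∈ omegaCenter r R := by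
    refine ⟨(z : R).2, fun y hy => ?_, ?_⟩
    · have := Subgroup.mem_center_iff.1 z.2 ⟨y, hy⟩
      exact (congrArg Subtype.val this).symm
    · have := orderOf_dvd_iff_pow_eq_one.1 hz.dvd
      simpa using congrArg (fun w : Subgroup.center R => ((w : R) : K)) this
  rw [hbot, Subgroup.mem_bot] at hmem
  have hz1 : z = 1 := Subtype.ext (Subtype.ext hmem)
  rw [hz1, orderOf_one] at hz
  exact hr.one_lt.ne hz

theorem mem_normalizer_zpowers_of_commute {K : Type*} [Group K] {u w : K} (h : Commute u w) :
    w ∈ Subgroup.normalizer (Subgroup.zpowers u : Set K) := by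
  have hconj : ∀ k : ℤ, w * u ^ k * w⁻¹ = u ^ k := fun k => by
    rw [(h.zpow_left k).symm.eq, mul_inv_cancel_right]
  rw [Subgroup.mem_normalizer_iff]
  intro x
  constructor
  · rintro ⟨k, rfl⟩
    simp only [hconj]
    exact ⟨k, rfl⟩
  · rintro ⟨k, hk⟩
    simp only at hk
    rw [← hconj k, mul_left_inj, mul_right_inj] at hk
    exact ⟨k, hk⟩

/-- An elementary abelian group in which triples are dependent is generated by two elements. -/
theorem omegaCenter_le_sup {K : Type*} [Group K] {r : ℕ} (hr : r.Prime) {R : Subgroup K}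
    (hdep : ∀ a ∈ R, ∀ b ∈ R, ∀ c ∈ R, a ∈ Subgroup.closure {b, c} ∨
      b ∈ Subgroup.closure {a, c} ∨ c ∈ Subgroup.closure {a, b})
    {u w : K} (hu : u ∈ omegaCenter r R) (hw : w ∈ omegaCenter r R) (hu1 : u ≠ 1)
    (hwu : w ∉ Subgroup.zpowers u) :
    omegaCenter r R ≤ Subgroup.zpowers u ⊔ Subgroup.zpowers w := by
  intro z hz
  have hcl : ∀ a b : K, Subgroup.closure {a, b} = Subgroup.zpowers a ⊔ Subgroup.zpowers b := by
    intro a b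
    rw [Set.insert_eq, Subgroup.closure_union, Subgroup.zpowers_eq_closure,
      Subgroup.zpowers_eq_closure]
  have hnorm : ∀ a ∈ R, Subgroup.zpowers a ≤ Subgroup.normalizer (Subgroup.zpowers z : Set K) := by
    intro a ha
    rw [Subgroup.zpowers_le]
    exact mem_normalizer_zpowers_of_commute (hz.2.1 a ha)
  have huw : u ∉ Subgroup.zpowers w := by
    rintro ⟨k, rfl⟩
    exact hwu (mem_zpowers_of_zpow_ne_one hr hw.2.2 hu1)
  rcases hdep u hu.1 w hw.1 z hz.1 with h | h | h
  · rw [hcl] at h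
    rw [sup_comm]
    exact exchange_of_normal hr hz.2.2 (Or.inl (hnorm w hw.1)) h huw
  · rw [hcl] at h
    exact exchange_of_normal hr hz.2.2 (Or.inl (hnorm u hu.1)) h hwu
  · rwa [hcl] at h

theorem prime_lt_or_of_mem_normalizer {K : Type*} [Group K] [Finite K]
    (hK : HasPrimePowerOrders K) {r s : ℕ} (hr : r.Prime) (hs : s.Prime) (hsr : s ≠ r)
    {R : Subgroup K} (hR : IsPGroup r R) (hR1 : R ≠ ⊥)
    (hdep : ∀ a ∈ R, ∀ b ∈ R, ∀ c ∈ R, a ∈ Subgroup.closure {b, c} ∨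
      b ∈ Subgroup.closure {a, c} ∨ c ∈ Subgroup.closure {a, b})
    {c : K} (hc : orderOf c = s) (hcR : c ∈ Subgroup.normalizer (R : Set K)) :
    s < r ∨ (r = 2 ∧ s = 3 ∧ ∃ a ∈ R, ∃ b ∈ R, a ≠ 1 ∧ b ≠ 1 ∧ a ≠ b ∧ a * a = 1 ∧ b * b = 1 ∧
      Commute a b) := by
  have : Fact r.Prime := ⟨hr⟩
  set W := omegaCenter r R with hWdef
  have hWp : IsPGroup r W := isPGroup_omegaCenter
  have hcs : c ^ s = 1 := orderOf_dvd_iff_pow_eq_one.1 hc.dvd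
  have hc1 : c ≠ 1 := fun h => by rw [h, orderOf_one] at hc; exact hs.one_lt.ne hc
  obtain ⟨u, hu, hu1⟩ := exists_mem_ne_one (omegaCenter_ne_bot hr hR hR1)
  have hmod : Nat.card W ≡ 1 [MOD s] := by
    refine card_modEq_one_of_fixedPointFree hs hcs (fun x hx => conj_mem_omegaCenter hcR hx) ?_
    intro x hx hfix
    refine (hK hr hs hsr.symm x c 1 1 (mul_inv_eq_iff_eq_mul.1 hfix).symm ?_
      (by rwa [pow_one])).resolve_right hc1
    rw [pow_one]
    exact hx.2.2
  obtain ⟨n, hn⟩ := IsPGroup.iff_card.1 hWp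
  have hn0 : n ≠ 0 := by
    rintro rfl
    rw [pow_zero, Subgroup.card_eq_one] at hn
    exact hu1 ((Subgroup.eq_bot_iff_forall W).1 hn u hu)
  have hzcard : ∀ x ∈ W, x ≠ 1 → Nat.card (Subgroup.zpowers x) = r := fun x hx hx1 => by
    rw [Nat.card_zpowers]
    exact orderOf_eq_prime hx.2.2 hx1
  rw [hn] at hmod
  have hdvd : s ∣ r ^ n - 1 := (Nat.modEq_iff_dvd' (Nat.one_le_pow _ _ hr.pos)).1 hmod.symm
  by_cases hWu : W ≤ Subgroup.zpowers u
  · left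
    have hle : r ^ n ≤ r := by
      rw [← hn, ← hzcard u hu hu1]
      exact Subgroup.card_le_of_le hWu
    have hle' : r ^ n ≤ r ^ 1 := by rwa [pow_one]
    have : n ≤ 1 := (Nat.pow_le_pow_iff_right hr.one_lt).1 hle'
    have hn1 : n = 1 := by omega
    rw [hn1, pow_one] at hdvd
    have := Nat.le_of_dvd (by have := hr.one_lt; omega) hdvd
    have := hr.one_lt
    omega
  · obtain ⟨w, hw, hwu⟩ := Set.not_subset.1 hWu
    have hw1 : w ≠ 1 := fun h => hwu (h ▸ one_mem _)
    have hsup := omegaCenter_le_sup hr hdep hu hw hu1 hwu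
    have hcomm : Commute u w := hu.2.1 w hw.1
    have hle : r ^ n ≤ r ^ 2 := by
      have hsurj : ∀ x : W, ∃ y : Subgroup.zpowers u × Subgroup.zpowers w,
          (y.1 : K) * (y.2 : K) = x := by
        intro x
        have hx := hsup x.2
        have hwn := mem_normalizer_zpowers_of_commute hcomm
        obtain ⟨v, hv, j, hj⟩ := exists_mul_zpow_of_mem_sup hwn hx
        exact ⟨(⟨v, hv⟩, ⟨w ^ j, zpow_mem (Subgroup.mem_zpowers w) j⟩), hj⟩
      choose f hf using hsurj
      have hinj : Function.Injective f := fun x y hxy => Subtype.ext (by rw [← hf x, hxy, hf y])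
      have := Nat.card_le_card_of_injective f hinj
      rwa [Nat.card_prod, hzcard u hu hu1, hzcard w hw hw1, hn, ← sq] at this
    have hn2 : n ≤ 2 := (Nat.pow_le_pow_iff_right hr.one_lt).1 hle
    have hlt : s < r ∨ s ∣ r + 1 := by
      have hcases : n = 1 ∨ n = 2 := by omega
      have hr1 := hr.one_lt
      rcases hcases with rfl | rfl
      · left
        rw [pow_one] at hdvd
        have := Nat.le_of_dvd (by omega) hdvd
        omega
      · have : r ^ 2 - 1 = (r + 1) * (r - 1) := by
          simpa using Nat.sq_sub_sq r 1
        rw [this] at hdvd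
        rcases hs.dvd_mul.1 hdvd with h | h
        · exact Or.inr h
        · left
          have := Nat.le_of_dvd (by omega) h
          omega
    rcases hlt with h | h
    · exact Or.inl h
    have hle1 := Nat.le_of_dvd (by omega) h
    by_cases hlt : s < r
    · exact Or.inl hlt
    have hsr1 : s = r + 1 := by omega
    have hr2 : r = 2 := by
      rcases hr.eq_two_or_odd' with h2 | h2
      · exact h2
      · have hs2 : s = 2 := by
          rcases hs.eq_two_or_odd' with h3 | h3
          · exact h3
          · rw [hsr1] at h3
            exact absurd h2.add_one (Nat.not_even_iff_odd.2 h3)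
        have := hr.one_lt
        omega
    refine Or.inr ⟨hr2, by omega, u, hu.1, w, hw.1, hu1, hw1, ?_, ?_, ?_, hcomm⟩
    · rintro rfl
      exact hwu (Subgroup.mem_zpowers _)
    · rw [← sq, ← hr2]; exact hu.2.2
    · rw [← sq, ← hr2]; exact hw.2.2

/-! ### Groups without normal primary subgroups -/

theorem exists_isPGroup_of_normalizer {K : Type*} [Group K] [Finite K]
    (hK : HasPrimePowerOrders K) (hno : ∀ (t : ℕ) (V : Subgroup K), t.Prime → V.Normal →
      IsPGroup t V → V = ⊥)
    (hS : ∀ H : Subgroup K, H ≠ ⊤ → IsPrimaryByPrimary H) {r : ℕ} (hr : r.Prime)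
    {D : Subgroup K} (hD : IsPGroup r D) (hD1 : D ≠ ⊥) :
    ∃ R : Subgroup K, IsPGroup r R ∧
      ∀ x ∈ Subgroup.normalizer (D : Set K), ∀ k : ℕ, x ^ r ^ k = 1 → x ∈ R := by
  set N := Subgroup.normalizer (D : Set K) with hN
  have hNtop : N ≠ ⊤ := fun h => hD1 (hno r D hr (Subgroup.normalizer_eq_top_iff.1 h) hD)
  have hDN : D ≤ N := Subgroup.le_normalizer
  have hYn : (D.subgroupOf N).Normal := Subgroup.normal_in_normalizer
  have hY : IsPGroup r (D.subgroupOf N) := isPGroup_subgroup_iff.2 fun x hx => by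
    obtain ⟨k, hk⟩ := isPGroup_subgroup_iff.1 hD x hx
    exact ⟨k, Subtype.ext (by simpa using hk)⟩
  have hY1 : D.subgroupOf N ≠ ⊥ := by
    obtain ⟨d, hd, hd1⟩ := exists_mem_ne_one hD1
    intro h
    have : (⟨d, hDN hd⟩ : N) ∈ D.subgroupOf N := hd
    rw [h, Subgroup.mem_bot] at this
    exact hd1 (congrArg Subtype.val this)
  obtain ⟨R, -, hR, s, hs, hsr, hg⟩ :=
    (hS N hNtop).exists_of_normal (hK.subgroup N) hr hYn hY hY1
  refine ⟨R.map N.subtype, hR.map _, fun x hx k hk => ?_⟩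
  obtain ⟨l, hl⟩ := hg ⟨x, hx⟩
  refine ⟨⟨x, hx⟩, mem_of_pow_prime_pow_mem hr hs hsr.symm (i := k) ?_ hl, rfl⟩
  have : (⟨x, hx⟩ : N) ^ r ^ k = 1 := Subtype.ext (by simpa using hk)
  rw [this]
  exact one_mem _

theorem exists_mem_normalizer_of_lt {K : Type*} [Group K] [Finite K] {r : ℕ} [Fact r.Prime]
    {D P : Subgroup K} (hP : IsPGroup r P) (hDP : D < P) :
    ∃ x ∈ P, x ∉ D ∧ x ∈ Subgroup.normalizer (D : Set K) := by
  have : Group.IsNilpotent P := hP.isNilpotent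
  have hlt : D.subgroupOf P < ⊤ := by
    rw [lt_top_iff_ne_top, Ne, Subgroup.subgroupOf_eq_top]
    exact hDP.not_ge
  obtain ⟨x, hx, hxD⟩ := SetLike.exists_of_lt (Group.normalizerCondition_of_isNilpotent _ hlt)
  refine ⟨x, x.2, hxD, ?_⟩
  rw [Subgroup.mem_normalizer_iff] at hx ⊢
  intro h
  constructor
  · intro hh
    exact (hx ⟨h, hDP.le hh⟩).1 hh
  · intro hh
    have h1 : h ∈ P := by
      have := mul_mem (mul_mem (inv_mem x.2) (hDP.le hh)) x.2
      simpa [mul_assoc] using this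
    exact (hx ⟨h, h1⟩).2 hh

theorem Sylow.eq_of_mem_of_ne_one {K : Type*} [Group K] [Finite K]
    (hK : HasPrimePowerOrders K) (hno : ∀ (t : ℕ) (V : Subgroup K), t.Prime → V.Normal →
      IsPGroup t V → V = ⊥)
    (hS : ∀ H : Subgroup K, H ≠ ⊤ → IsPrimaryByPrimary H) {r : ℕ} [hr : Fact r.Prime]
    {P Q : Sylow r K} {x : K} (hxP : x ∈ P) (hxQ : x ∈ Q) (hx1 : x ≠ 1) : P = Q := by
  by_contra hPQ
  obtain ⟨⟨P, Q⟩, hne, hmax⟩ := Set.Finite.exists_maximalFor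
    (fun z : Sylow r K × Sylow r K => Nat.card (z.1 ⊓ z.2 : Subgroup K))
    {z | z.1 ≠ z.2 ∧ (z.1 ⊓ z.2 : Subgroup K) ≠ ⊥} (Set.toFinite _)
    ⟨(P, Q), hPQ, fun h => hx1 ((Subgroup.eq_bot_iff_forall _).1 h x ⟨hxP, hxQ⟩)⟩
  clear hxP hxQ hPQ
  obtain ⟨hPQ, hbot⟩ := hne
  simp only at hPQ hbot
  set D : Subgroup K := (P ⊓ Q : Subgroup K) with hDdef
  have hDp : IsPGroup r D := P.2.to_le inf_le_left
  obtain ⟨R, hR, hRmem⟩ := exists_isPGroup_of_normalizer hK hno hS hr.out hDp hbot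
  obtain ⟨T, hRT⟩ := hR.exists_le_sylow
  have hDT : D ≤ T := by
    intro d hd
    obtain ⟨k, hk⟩ := isPGroup_subgroup_iff.1 hDp d hd
    exact hRT (hRmem d (Subgroup.le_normalizer hd) k hk)
  have key : ∀ S : Sylow r K, D < S → S = T := by
    intro S hDS
    by_contra hne
    obtain ⟨y, hyS, hyD, hyN⟩ := exists_mem_normalizer_of_lt S.2 hDS
    obtain ⟨k, hk⟩ := isPGroup_subgroup_iff.1 S.2 y hyS
    have hyT : y ∈ T := hRT (hRmem y hyN k hk)
    have hlt : D < (S ⊓ T : Subgroup K) :=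
      lt_of_le_of_ne (le_inf hDS.le hDT) fun h => hyD (h ▸ ⟨hyS, hyT⟩)
    have hle := hmax (j := (S, T)) ⟨hne, fun h => hbot (le_bot_iff.1 (h ▸ hlt.le))⟩
      (Subgroup.card_le_of_le hlt.le)
    exact hlt.ne (Subgroup.eq_of_le_of_card_ge hlt.le hle)
  have hDP : D < P := lt_of_le_of_ne inf_le_left fun h =>
    hPQ (Sylow.ext (P.3 Q.2 (inf_eq_left.1 h)).symm)
  have hDQ : D < Q := lt_of_le_of_ne inf_le_right fun h =>
    hPQ (Sylow.ext (Q.3 P.2 (inf_eq_right.1 h)))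
  exact hPQ ((key P hDP).trans (key Q hDQ).symm)

theorem exists_orderOf_pow_eq_prime {K : Type*} [Group K] [Finite K] {g : K} (hg : g ≠ 1) {t k : ℕ}
    (ht : t.Prime) (hk : g ^ t ^ k = 1) : ∃ j : ℕ, orderOf (g ^ j) = t := by
  obtain ⟨m, -, hm⟩ := (Nat.dvd_prime_pow ht).1 (orderOf_dvd_of_pow_eq_one hk)
  have hm0 : m ≠ 0 := by
    rintro rfl
    exact hg (orderOf_eq_one_iff.1 (by rw [hm, pow_zero]))
  exact ⟨_, orderOf_pow_orderOf_div (orderOf_pos g).ne' (hm ▸ dvd_pow_self t hm0)⟩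

theorem Sylow.mem_of_mem_normalizer {K : Type*} [Group K] [Finite K] {r : ℕ} [Fact r.Prime]
    (R : Sylow r K) {x : K} (hx : x ∈ Subgroup.normalizer ((R : Subgroup K) : Set K)) {k : ℕ}
    (hk : x ^ r ^ k = 1) : x ∈ R := by
  have hz : IsPGroup r (Subgroup.zpowers x) :=
    isPGroup_subgroup_iff.2 fun y hy => ⟨k, pow_eq_one_of_mem_zpowers hk hy⟩
  have := hz.inf_normalizer_sylow R
  exact (this.le ⟨Subgroup.mem_zpowers x, hx⟩).2

/-- An element normalizing a Sylow subgroup and lying outside of it yields an element of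
another prime order doing so. -/
theorem HasPrimePowerOrders.exists_prime_order_mem_normalizer {K : Type*} [Group K] [Finite K]
    (hK : HasPrimePowerOrders K) {r : ℕ} [Fact r.Prime] (R : Sylow r K)
    (h : ¬ Subgroup.normalizer ((R : Subgroup K) : Set K) ≤ R) :
    ∃ t : ℕ, t.Prime ∧ t ≠ r ∧ ∃ c ∈ Subgroup.normalizer ((R : Subgroup K) : Set K),
      orderOf c = t := by
  obtain ⟨g, hg, hgR⟩ := Set.not_subset.1 h
  obtain ⟨t, ht, k, hk⟩ := hK.exists_pow_eq_one g
  have hg1 : g ≠ 1 := fun h1 => hgR (h1 ▸ one_mem _)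
  obtain ⟨j, hj⟩ := exists_orderOf_pow_eq_prime hg1 ht hk
  exact ⟨t, ht, fun htr => hgR (R.mem_of_mem_normalizer hg (htr ▸ hk)), g ^ j, pow_mem hg j, hj⟩

/-- Elements of the dihedral group generated by two involutions. -/
theorem exists_zpow_of_mem_closure_involutions {K : Type*} [Group K] {a c x : K} (ha : a * a = 1)
    (hc : c * c = 1) (hx : x ∈ Subgroup.closure {a, c}) :
    ∃ k : ℤ, x = (a * c) ^ k ∨ x = (a * c) ^ k * a := by
  have hai : a⁻¹ = a := inv_eq_of_mul_eq_one_left ha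
  have hci : c⁻¹ = c := inv_eq_of_mul_eq_one_left hc
  have hinv : a * (a * c) * a⁻¹ = (a * c)⁻¹ := by
    rw [mul_inv_rev, hai, hci, ← mul_assoc, ha, one_mul]
  have hnorm : a ∈ Subgroup.normalizer (Subgroup.zpowers (a * c) : Set K) := by
    have hconj : ∀ k : ℤ, a * (a * c) ^ k * a⁻¹ = (a * c) ^ (-k) := fun k => by
      rw [← conj_zpow, hinv, inv_zpow']
    rw [Subgroup.mem_normalizer_iff]
    intro h
    constructor
    · rintro ⟨k, rfl⟩
      simp only [hconj]
      exact ⟨-k, rfl⟩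
    · rintro ⟨k, hk⟩
      simp only at hk
      rw [← neg_neg k, ← hconj, mul_left_inj, mul_right_inj] at hk
      exact ⟨-k, hk⟩
  have hle : Subgroup.closure {a, c} ≤ Subgroup.zpowers (a * c) ⊔ Subgroup.zpowers a := by
    rw [Subgroup.closure_le]
    have h1 := Subgroup.mem_sup_right (S := Subgroup.zpowers (a * c)) (Subgroup.mem_zpowers a)
    rintro z (rfl | rfl)
    · exact h1
    · have := mul_mem h1 (Subgroup.mem_sup_left (T := Subgroup.zpowers a)
        (Subgroup.mem_zpowers (a * z)))
      rwa [← mul_assoc, ha, one_mul] at this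
  obtain ⟨_, ⟨k, rfl⟩, j, rfl⟩ := exists_mul_zpow_of_mem_sup hnorm (hle hx)
  rcases Int.even_or_odd' j with ⟨m, rfl | rfl⟩
  · exact ⟨k, Or.inl (by rw [zpow_mul, zpow_two, ha, one_zpow, mul_one])⟩
  · exact ⟨k, Or.inr (by rw [zpow_add, zpow_mul, zpow_two, ha, one_zpow, one_mul, zpow_one])⟩

/-- Two involutions in different Sylow subgroups have a product of odd prime-power order. -/
theorem exists_odd_prime_pow_mul_eq_one {K : Type*} [Group K] [Finite K]
    (hK : HasPrimePowerOrders K) {P : Sylow 2 K}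
    (hTI : ∀ (Q : Sylow 2 K) (x : K), x ∈ P → x ∈ Q → x ≠ 1 → P = Q)
    {a c : K} (haP : a ∈ P) (ha1 : a ≠ 1) (ha : a * a = 1) (hcP : c ∉ P) (hc : c * c = 1) :
    ∃ t : ℕ, t.Prime ∧ t ≠ 2 ∧ ∃ k : ℕ, (a * c) ^ t ^ k = 1 := by
  obtain ⟨t, ht, k, hk⟩ := hK.exists_pow_eq_one (a * c)
  refine ⟨t, ht, ?_, k, hk⟩
  rintro rfl
  have : Fact (Nat.Prime 2) := ⟨Nat.prime_two⟩
  have hcl : IsPGroup 2 (Subgroup.closure {a, c}) := by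
    refine isPGroup_subgroup_iff.2 fun x hx => ?_
    obtain ⟨j, rfl | rfl⟩ := exists_zpow_of_mem_closure_involutions ha hc hx
    · exact ⟨k, pow_eq_one_of_mem_zpowers hk ⟨j, rfl⟩⟩
    · have hai : a⁻¹ = a := inv_eq_of_mul_eq_one_left ha
      have hci : c⁻¹ = c := inv_eq_of_mul_eq_one_left hc
      have hinv : a * (a * c) * a⁻¹ = (a * c)⁻¹ := by
        rw [mul_inv_rev, hai, hci, ← mul_assoc, ha, one_mul]
      refine ⟨1, ?_⟩
      calc ((a * c) ^ j * a) ^ 2 ^ 1 = (a * c) ^ j * (a * (a * c) ^ j * a⁻¹) * (a * a) := by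
            rw [pow_one, sq]; group
        _ = 1 := by rw [← conj_zpow, hinv, inv_zpow, mul_inv_cancel, ha, one_mul]
  obtain ⟨T, hT⟩ := hcl.exists_le_sylow
  have haT : a ∈ T := hT (Subgroup.subset_closure (Or.inl rfl))
  have hcT : c ∈ T := hT (Subgroup.subset_closure (Or.inr rfl))
  exact hcP (hTI T a haP haT ha1 ▸ hcT)

theorem notMem_closure_involutions {K : Type*} [Group K] [Finite K]
    (hK : HasPrimePowerOrders K) {P : Sylow 2 K}
    (hTI : ∀ (Q : Sylow 2 K) (x : K), x ∈ P → x ∈ Q → x ≠ 1 → P = Q)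
    {a b c : K} (haP : a ∈ P) (ha1 : a ≠ 1) (ha : a * a = 1) (hb1 : b ≠ 1) (hb : b * b = 1)
    (hab : Commute a b) (hne : a ≠ b) (hcP : c ∉ P) (hc : c * c = 1) :
    b ∉ Subgroup.closure {a, c} := by
  intro h
  obtain ⟨t, ht, ht2, k, hk⟩ := exists_odd_prime_pow_mul_eq_one hK hTI haP ha1 ha hcP hc
  have hsq : ∀ y : K, y * y = 1 → y ∈ Subgroup.zpowers (a * c) → y = 1 := by
    intro y hy hmem
    exact eq_one_of_pow_prime_pow ht Nat.prime_two ht2 (pow_eq_one_of_mem_zpowers hk hmem)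
      (j := 1) (by rw [pow_one, sq, hy])
  obtain ⟨j, hj | hj⟩ := exists_zpow_of_mem_closure_involutions ha hc h
  · exact hb1 (hsq b hb ⟨j, hj.symm⟩)
  · have h1 : b * a = (a * c) ^ j := by rw [hj, mul_assoc, ha, mul_one]
    have h2 : b * a = 1 := by
      refine hsq _ ?_ ⟨j, h1.symm⟩
      rw [hab.mul_mul_mul_comm, hb, ha, mul_one]
    rw [← ha, mul_left_inj] at h2
    exact hne h2.symm

theorem Sylow.false_of_commuting_involutions {K : Type*} [Group K] [Finite K]
    (hK : HasPrimePowerOrders K) (hD : TriplesDependent K)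
    (hno : ∀ (t : ℕ) (V : Subgroup K), t.Prime → V.Normal → IsPGroup t V → V = ⊥)
    {P : Sylow 2 K} (hTI : ∀ (Q : Sylow 2 K) (x : K), x ∈ P → x ∈ Q → x ≠ 1 → P = Q)
    {a b : K} (haP : a ∈ P) (hbP : b ∈ P) (ha1 : a ≠ 1) (hb1 : b ≠ 1) (hne : a ≠ b)
    (ha : a * a = 1) (hb : b * b = 1) (hab : Commute a b) : False := by
  obtain ⟨g, hg⟩ : ∃ g : K, g * a * g⁻¹ ∉ P := by
    by_contra! h
    have hle : Subgroup.normalClosure {a} ≤ P := by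
      rw [Subgroup.normalClosure, Subgroup.closure_le]
      intro x hx
      obtain ⟨y, rfl, hy⟩ := Group.mem_conjugatesOfSet_iff.1 hx
      obtain ⟨g, rfl⟩ := isConj_iff.1 hy
      exact h g
    have := hno 2 _ Nat.prime_two Subgroup.normalClosure_normal (P.2.to_le hle)
    exact ha1 ((Subgroup.eq_bot_iff_forall _).1 this a
      (Subgroup.subset_normalClosure (Set.mem_singleton a)))
  set c := g * a * g⁻¹ with hcdef
  have hc : c * c = 1 := by
    rw [hcdef, ← sq, conj_pow, sq, ha, mul_one, mul_inv_cancel]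
  rcases hD a b c with h | h | h
  · exact notMem_closure_involutions hK hTI hbP hb1 hb ha1 ha hab.symm hne.symm hg hc h
  · exact notMem_closure_involutions hK hTI haP ha1 ha hb1 hb hab hne hg hc h
  · refine hg ((Subgroup.closure_le (P : Subgroup K)).2 ?_ h)
    rintro z (rfl | rfl)
    · exact haP
    · exact hbP

theorem Sylow.exists_finset_card {K : Type*} [Group K] [Finite K] {p : ℕ} [Fact p.Prime]
    (hTI : ∀ (P Q : Sylow p K) (x : K), x ∈ P → x ∈ Q → x ≠ 1 → P = Q) (P : Sylow p K) :
    ∃ S : Finset K, S.card = Nat.card (Sylow p K) * (Nat.card P - 1) ∧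
      ∀ x ∈ S, x ≠ 1 ∧ ∃ k : ℕ, x ^ p ^ k = 1 := by
  classical
  have := Fintype.ofFinite K
  have := Fintype.ofFinite (Sylow p K)
  refine ⟨Finset.univ.biUnion fun Q : Sylow p K => ((Q : Set K).toFinset).erase 1, ?_, ?_⟩
  · rw [Finset.card_biUnion]
    · rw [Finset.sum_congr rfl (g := fun _ => Nat.card P - 1)]
      · simp [Nat.card_eq_fintype_card]
      · intro Q _
        rw [Finset.card_erase_of_mem (by simp [one_mem]), Set.toFinset_card,
          ← Nat.card_eq_fintype_card, P.card_eq_multiplicity]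
        congr 1
        exact Q.card_eq_multiplicity
    · intro Q _ Q' _ hne
      rw [Function.onFun, Finset.disjoint_left]
      intro x hx hx'
      simp only [Finset.mem_erase, Set.mem_toFinset, SetLike.mem_coe] at hx hx'
      exact hne (hTI Q Q' x hx.2 hx'.2 hx.1)
  · intro x hx
    simp only [Finset.mem_biUnion, Finset.mem_univ, true_and, Finset.mem_erase, Set.mem_toFinset,
      SetLike.mem_coe] at hx
    obtain ⟨Q, hx1, hxQ⟩ := hx
    exact ⟨hx1, isPGroup_subgroup_iff.1 Q.2 x hxQ⟩

theorem Sylow.card_count_le {K : Type*} [Group K] [Finite K] {p r : ℕ} [hp : Fact p.Prime]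
    [hr : Fact r.Prime] (hpr : p ≠ r)
    (hTIp : ∀ (P Q : Sylow p K) (x : K), x ∈ P → x ∈ Q → x ≠ 1 → P = Q)
    (hTIr : ∀ (P Q : Sylow r K) (x : K), x ∈ P → x ∈ Q → x ≠ 1 → P = Q)
    (P : Sylow p K) (R : Sylow r K) :
    Nat.card (Sylow p K) * (Nat.card P - 1) + Nat.card (Sylow r K) * (Nat.card R - 1) + 1 ≤
      Nat.card K := by
  classical
  have := Fintype.ofFinite K
  obtain ⟨S, hS, hS'⟩ := Sylow.exists_finset_card hTIp P
  obtain ⟨T, hT, hT'⟩ := Sylow.exists_finset_card hTIr R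
  have hST : Disjoint S T := by
    rw [Finset.disjoint_left]
    intro x hx hx'
    obtain ⟨hx1, i, hi⟩ := hS' x hx
    obtain ⟨-, j, hj⟩ := hT' x hx'
    exact hx1 (eq_one_of_pow_prime_pow hp.out hr.out hpr hi hj)
  have h1 : (1 : K) ∉ S ∪ T := by
    rw [Finset.mem_union]
    rintro (h | h)
    · exact (hS' 1 h).1 rfl
    · exact (hT' 1 h).1 rfl
  rw [← hS, ← hT, ← Finset.card_union_of_disjoint hST, ← Finset.card_insert_of_notMem h1,
    Nat.card_eq_fintype_card]
  exact Finset.card_le_univ _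

/-- The numerical contradiction behind the count of elements in two families of Sylow
subgroups. -/
theorem false_of_sylow_count {N a b P R c : ℕ} (hP : a * P = N) (hR : b * (R * c) = N)
    (hc : 0 < c) (hP2 : 2 * c ≤ P) (hR2 : 2 ≤ R)
    (h : a * (P - 1) + b * (R - 1) + 1 ≤ N) : False := by
  have h1 : a * (P - 1) + a = N := by
    rw [← hP, ← Nat.mul_succ]; congr 1; omega
  have h2 : b * (R - 1) + b = b * R := by
    rw [← Nat.mul_succ]; congr 1; omega
  have h3 : c * (2 * a) ≤ c * (b * R) := by
    calc c * (2 * a) = a * (2 * c) := by ring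
      _ ≤ a * P := Nat.mul_le_mul_left _ hP2
      _ = c * (b * R) := by rw [hP, ← hR]; ring
  have h4 : 2 * a ≤ b * R := Nat.le_of_mul_le_mul_left h3 hc
  have h5 : b * 2 ≤ b * R := Nat.mul_le_mul_left _ hR2
  omega

theorem Sylow.normalizer_le_of_forall_le {K : Type*} [Group K] [Finite K]
    (hK : HasPrimePowerOrders K) (hD : TriplesDependent K)
    (hno : ∀ (t : ℕ) (V : Subgroup K), t.Prime → V.Normal → IsPGroup t V → V = ⊥)
    (hS : ∀ H : Subgroup K, H ≠ ⊤ → IsPrimaryByPrimary H) {p : ℕ} [hp : Fact p.Prime]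
    (hmin : ∀ t : ℕ, t.Prime → t ∣ Nat.card K → p ≤ t) (hdvd : p ∣ Nat.card K)
    (P : Sylow p K) : Subgroup.normalizer ((P : Subgroup K) : Set K) ≤ P := by
  by_contra h
  obtain ⟨t, ht, htp, c, hc, hct⟩ := hK.exists_prime_order_mem_normalizer P h
  rcases prime_lt_or_of_mem_normalizer hK hp.out ht htp P.2 (P.ne_bot_of_dvd_card hdvd)
    (fun a _ b _ c _ => hD a b c) hct hc with hlt |
      ⟨rfl, -, a, haP, b, hbP, ha1, hb1, hne, ha, hb, hab⟩
  · exact absurd (hmin t ht (hct ▸ orderOf_dvd_natCard c)) (not_le.2 hlt)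
  · exact Sylow.false_of_commuting_involutions hK hD hno
      (fun Q x hx hx' hx1 => Sylow.eq_of_mem_of_ne_one hK hno hS hx hx' hx1) haP hbP ha1 hb1 hne ha
      hb hab

theorem Sylow.exists_card_normalizer_eq {K : Type*} [Group K] [Finite K]
    (hK : HasPrimePowerOrders K) (hD : TriplesDependent K) {p r : ℕ} (hp : p.Prime)
    [hr : Fact r.Prime] (hpr : p ≠ r)
    (hmin : ∀ t : ℕ, t.Prime → t ∣ Nat.card K → p ≤ t)
    (hmin' : ∀ t : ℕ, t.Prime → t ∣ Nat.card K → t ≠ p → r ≤ t) (hdvd : r ∣ Nat.card K)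
    (R : Sylow r K) :
    ∃ k : ℕ, Nat.card (Subgroup.normalizer ((R : Subgroup K) : Set K)) = Nat.card R * p ^ k := by
  set N := Subgroup.normalizer ((R : Subgroup K) : Set K) with hN
  have hRN : (R : Subgroup K) ≤ N := Subgroup.le_normalizer
  set c := (R : Subgroup K).relIndex N with hc
  have hcard : c * Nat.card R = Nat.card N := by
    have := Subgroup.relIndex_mul_relIndex ⊥ (R : Subgroup K) N bot_le hRN
    rwa [Subgroup.relIndex_bot_left, Subgroup.relIndex_bot_left, mul_comm] at this
  have hci : c * N.index = (R : Subgroup K).index := Subgroup.relIndex_mul_index hRN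
  have hrc : ¬ r ∣ c := fun h => R.not_dvd_index (h.trans (Dvd.intro _ hci))
  have hc0 : c ≠ 0 := by
    intro h
    exact hrc (h ▸ dvd_zero r)
  suffices ∀ {t : ℕ}, t.Prime → t ∣ c → t = p from
    ⟨_, by rw [← hcard, mul_comm, ← Nat.eq_prime_pow_of_unique_prime_dvd hc0 this]⟩
  intro t ht htc
  have : Fact t.Prime := ⟨ht⟩
  obtain ⟨x, hx⟩ := exists_prime_orderOf_dvd_card' (G := N) t (htc.trans (Dvd.intro _ hcard))
  have hx' : orderOf (x : K) = t := by rw [Subgroup.orderOf_coe, hx]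
  have htK : t ∣ Nat.card K := hx' ▸ orderOf_dvd_natCard (x : K)
  have htr : t ≠ r := fun h => hrc (h ▸ htc)
  by_contra htp
  rcases prime_lt_or_of_mem_normalizer hK hr.out ht htr R.2 (R.ne_bot_of_dvd_card hdvd)
    (fun a _ b _ c _ => hD a b c) hx' x.2 with hlt | ⟨hr2, -⟩
  · exact absurd (hmin' t ht htK htp) (not_le.2 hlt)
  · have h1 := hmin r hr.out hdvd
    have h2 := hp.two_le
    omega

theorem IsPrimaryByPrimary.eq_bot_of_normal {K : Type*} [Group K]
    (hno : ∀ (t : ℕ) (V : Subgroup K), t.Prime → V.Normal → IsPGroup t V → V = ⊥)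
    {T : Subgroup K} (hT : T.Normal) (hS : IsPrimaryByPrimary T) : T = ⊥ := by
  obtain ⟨p, q, hp, hq, hpq, P, hPn, hP, hg⟩ := hS
  have hPmem : ∀ x : T, (∃ k : ℕ, x ^ p ^ k = 1) → x ∈ P := by
    rintro x ⟨k, hk⟩
    obtain ⟨l, hl⟩ := hg x
    exact mem_of_pow_prime_pow_mem hp hq hpq (i := k) (hk ▸ one_mem _) hl
  have hbot : P.map T.subtype = ⊥ := by
    refine hno p _ hp ⟨?_⟩ (hP.map _)
    rintro _ ⟨x, hx, rfl⟩ g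
    refine ⟨⟨g * x * g⁻¹, hT.conj_mem x x.2 g⟩, hPmem _ ?_, rfl⟩
    obtain ⟨k, hk⟩ := isPGroup_subgroup_iff.1 hP x hx
    refine ⟨k, Subtype.ext ?_⟩
    have : (x : K) ^ p ^ k = 1 := by simpa using congrArg Subtype.val hk
    simp [conj_pow, this]
  refine hno q T hq hT fun x => ?_
  obtain ⟨k, hk⟩ := hg x
  refine ⟨k, Subtype.ext ?_⟩
  have := (Subgroup.eq_bot_iff_forall _).1 hbot _ (Subgroup.mem_map_of_mem T.subtype hk)
  simpa using this

theorem Sylow.normal_complement_of_self_normalizing {K : Type*} [Group K] [Finite K] {p : ℕ}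
    [hp : Fact p.Prime] (P : Sylow p K)
    (hP : Subgroup.normalizer ((P : Subgroup K) : Set K) ≤ P)
    (hcomm : ∀ a ∈ P, ∀ b ∈ P, a * b = b * a) :
    ∃ T : Subgroup K, T.Normal ∧ T.IsComplement' P := by
  have hcent : Subgroup.normalizer ((P : Subgroup K) : Set K) ≤
      Subgroup.centralizer ((P : Subgroup K) : Set K) := fun x hx =>
    Subgroup.mem_centralizer_iff.2 fun h hh => hcomm h hh x (hP hx)
  exact ⟨_, MonoidHom.normal_ker _, MonoidHom.ker_transferSylow_isComplement' P hcent⟩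

theorem Sylow.false_of_le_normalizer {K : Type*} [Group K] [Finite K]
    (hD : TriplesDependent K)
    (hno : ∀ (t : ℕ) (V : Subgroup K), t.Prime → V.Normal → IsPGroup t V → V = ⊥)
    (hS : ∀ H : Subgroup K, H ≠ ⊤ → IsPrimaryByPrimary H) {p r : ℕ} [hp : Fact p.Prime]
    [hr : Fact r.Prime] (hpr : p ≠ r) (hpK : p ∣ Nat.card K) (hrK : r ∣ Nat.card K)
    (P : Sylow p K) (R : Sylow r K) (hP : Subgroup.normalizer ((P : Subgroup K) : Set K) ≤ P)
    (hPR : (P : Subgroup K) ≤ Subgroup.normalizer ((R : Subgroup K) : Set K)) : False := by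
  obtain ⟨ρ, hρ, hρ1⟩ := exists_mem_ne_one (R.ne_bot_of_dvd_card hrK)
  have hcyc : ∀ a ∈ P, ∀ b ∈ P, a ∈ Subgroup.closure {ρ, b} → a ∈ Subgroup.zpowers b := by
    intro a ha b hb hab
    obtain ⟨u, hu, j, rfl⟩ := exists_mul_zpow_of_mem_sup (hPR hb)
      (closure_pair_le_sup_zpowers hρ hab)
    have huP : u ∈ P := by
      have := mul_mem ha (inv_mem (zpow_mem hb j))
      rwa [mul_inv_cancel_right] at this
    rw [disjoint_of_isPGroup_ne hp.out hr.out hpr P.2 R.2 huP hu, one_mul]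
    exact zpow_mem (Subgroup.mem_zpowers b) j
  have hzcomm : ∀ a b : K, a ∈ Subgroup.zpowers b → a * b = b * a := by
    rintro _ b ⟨j, rfl⟩
    exact ((Commute.refl b).zpow_left j).eq
  have hcomm : ∀ a ∈ P, ∀ b ∈ P, a * b = b * a := by
    intro a ha b hb
    rcases hD ρ a b with h | h | h
    · refine absurd (disjoint_of_isPGroup_ne hp.out hr.out hpr P.2 R.2 ?_ hρ) hρ1
      refine (Subgroup.closure_le (P : Subgroup K)).2 ?_ h
      rintro z (rfl | rfl)
      · exact ha
      · exact hb
    · exact hzcomm a b (hcyc a ha b hb h)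
    · exact (hzcomm b a (hcyc b hb a ha h)).symm
  obtain ⟨T, hT, hTP⟩ := P.normal_complement_of_self_normalizing hP hcomm
  have hcard := hTP.card_mul_card
  have hTtop : T ≠ ⊤ := by
    rintro rfl
    rw [Subgroup.card_top] at hcard
    have h1 : Nat.card P = 1 := Nat.eq_of_mul_eq_mul_left Nat.card_pos
      (hcard.trans (mul_one _).symm)
    exact P.ne_bot_of_dvd_card hpK (Subgroup.eq_bot_of_card_eq _ h1)
  have hTbot := IsPrimaryByPrimary.eq_bot_of_normal hno hT (hS T hTtop)
  rw [hTbot, Subgroup.card_bot, one_mul] at hcard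
  obtain ⟨n, hn⟩ := IsPGroup.iff_card.1 P.2
  change Nat.card P = p ^ n at hn
  rw [← hcard] at hrK
  change r ∣ Nat.card P at hrK
  rw [hn] at hrK
  exact hpr ((Nat.prime_dvd_prime_iff_eq hr.out hp.out).1 (hr.out.dvd_of_dvd_pow hrK)).symm

theorem exists_prime_ne_dvd_card {K : Type*} [Group K] [Finite K] {p : ℕ}
    (h : ¬ IsPGroup p K) : ∃ r : ℕ, r.Prime ∧ r ∣ Nat.card K ∧ r ≠ p := by
  by_contra! hcon
  exact h (IsPGroup.of_card (Nat.eq_prime_pow_of_unique_prime_dvd Nat.card_pos.ne'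
    fun {d} hd hdK => hcon d hd hdK))

theorem false_of_no_normal_isPGroup {K : Type*} [Group K] [Finite K] [Nontrivial K]
    (hK : HasPrimePowerOrders K) (hD : TriplesDependent K)
    (hno : ∀ (t : ℕ) (V : Subgroup K), t.Prime → V.Normal → IsPGroup t V → V = ⊥)
    (hS : ∀ H : Subgroup K, H ≠ ⊤ → IsPrimaryByPrimary H) : False := by
  classical
  have hp : (Nat.card K).minFac.Prime := Nat.minFac_prime Finite.one_lt_card.ne'
  have hmin : ∀ t : ℕ, t.Prime → t ∣ Nat.card K → (Nat.card K).minFac ≤ t :=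
    fun t ht h => Nat.minFac_le_of_dvd ht.two_le h
  have hpK : (Nat.card K).minFac ∣ Nat.card K := Nat.minFac_dvd _
  generalize (Nat.card K).minFac = p at hp hmin hpK
  have hex : ∃ r : ℕ, r.Prime ∧ r ∣ Nat.card K ∧ r ≠ p := by
    refine exists_prime_ne_dvd_card fun h => ?_
    have := hno p ⊤ hp inferInstance (h.to_subgroup _)
    exact bot_ne_top this.symm
  obtain ⟨hr, hrK, hrp⟩ := Nat.find_spec hex
  have hmin' : ∀ t : ℕ, t.Prime → t ∣ Nat.card K → t ≠ p → Nat.find hex ≤ t :=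
    fun t ht h htp => Nat.find_min' hex ⟨ht, h, htp⟩
  generalize Nat.find hex = r at hr hrK hrp hmin'
  have : Fact p.Prime := ⟨hp⟩
  have : Fact r.Prime := ⟨hr⟩
  obtain ⟨P⟩ : Nonempty (Sylow p K) := inferInstance
  obtain ⟨R⟩ : Nonempty (Sylow r K) := inferInstance
  have hself := Sylow.normalizer_le_of_forall_le hK hD hno hS hmin hpK
  obtain ⟨k, hk⟩ := Sylow.exists_card_normalizer_eq hK hD hp hrp.symm hmin hmin' hrK R
  set N := Subgroup.normalizer ((R : Subgroup K) : Set K) with hN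
  have hNdvd : Nat.card R * p ^ k ∣ Nat.card K := hk ▸ Subgroup.card_subgroup_dvd_card N
  have hkP : p ^ k ∣ Nat.card P := P.pow_dvd_card_of_pow_dvd_card (dvd_of_mul_left_dvd hNdvd)
  obtain ⟨d, hd⟩ := hkP
  have hd0 : d ≠ 0 := by
    rintro rfl
    rw [mul_zero] at hd
    exact Nat.card_pos.ne' hd
  by_cases hd1 : d = 1
  · rw [hd1, mul_one] at hd
    obtain ⟨Q, hQ⟩ := Sylow.exists_subgroup_card_pow_prime (G := N) p
      (n := k) (hk ▸ Dvd.intro_left _ rfl)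
    have hQcard : Nat.card (Q.map N.subtype) = Nat.card P := by
      rw [Subgroup.card_map_of_injective N.subtype_injective, hQ, hd]
    rw [P.card_eq_multiplicity] at hQcard
    exact Sylow.false_of_le_normalizer hD hno hS hrp.symm hpK hrK (Sylow.ofCard _ hQcard) R
      (hself _) (Subgroup.map_subtype_le Q)
  · have hTI : ∀ (q : ℕ) [Fact q.Prime] (P Q : Sylow q K) (x : K), x ∈ P → x ∈ Q → x ≠ 1 → P = Q :=
      fun q _ P Q x hP hQ hx => Sylow.eq_of_mem_of_ne_one hK hno hS hP hQ hx
    have hcount := Sylow.card_count_le hrp.symm (hTI p) (hTI r) P R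
    have hNP : Subgroup.normalizer ((P : Subgroup K) : Set K) = P :=
      le_antisymm (hself P) Subgroup.le_normalizer
    have h1 : Nat.card (Sylow p K) * Nat.card P = Nat.card K := by
      rw [P.card_eq_index_normalizer]
      change (Subgroup.normalizer ((P : Subgroup K) : Set K)).index * _ = _
      rw [hNP]
      exact (P : Subgroup K).index_mul_card
    have h2 : Nat.card (Sylow r K) * (Nat.card R * p ^ k) = Nat.card K := by
      rw [R.card_eq_index_normalizer, ← hk]
      exact N.index_mul_card
    refine false_of_sylow_count h1 h2 (pow_pos hp.pos k) ?_ ?_ hcount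
    · rw [hd, mul_comm]
      exact Nat.mul_le_mul_left _ (by omega)
    · have hR := (Subgroup.one_lt_card_iff_ne_bot _).2 (R.ne_bot_of_dvd_card hrK)
      exact hR

/-- A finite group whose elements have prime-power order and whose triples are dependent is
an extension of a primary group by a primary group. -/
theorem isPrimaryByPrimary_of_dependent {K : Type*} [Group K] [Finite K]
    (hK : HasPrimePowerOrders K) (hD : TriplesDependent K) : IsPrimaryByPrimary K := by
  induction hn : Nat.card K using Nat.strong_induction_on generalizing K with
  | _ n ih =>
    subst hn
    by_contra hcon
    have hnt : Nontrivial K := by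
      rw [← not_subsingleton_iff_nontrivial]
      intro h
      exact hcon (IsPGroup.isPrimaryByPrimary Nat.prime_two fun g => ⟨0, Subsingleton.elim _ _⟩)
    refine false_of_no_normal_isPGroup hK hD ?_ ?_
    · intro t V ht hVn hV
      by_contra hV1
      refine hcon (isPrimaryByPrimary_of_quotient hK hD ht hV hV1 ?_)
      refine ih _ ?_ (hK.of_surjective (QuotientGroup.mk'_surjective V))
        (hD.of_surjective (QuotientGroup.mk'_surjective V)) rfl
      rw [← V.index_eq_card, ← V.index_mul_card]
      exact lt_mul_of_one_lt_right (Nat.pos_of_ne_zero V.index_ne_zero_of_finite)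
        ((Subgroup.one_lt_card_iff_ne_bot V).2 hV1)
    · intro H hH
      exact ih _ (lt_of_le_of_ne H.card_le_card_group fun h => hH (H.eq_top_of_card_eq h))
        (hK.subgroup H) (hD.subgroup H) rfl

/-! ### Existence of a normal primary subgroup -/

theorem exists_normal_isPGroup_of_mul_closed {G : Type*} [Group G] [Finite G] {p : ℕ}
    (hp : p.Prime) (hdvd : p ∣ Nat.card G)
    (h : ∀ (x y : G) (i j : ℕ), x ^ p ^ i = 1 → y ^ p ^ j = 1 → ∃ k : ℕ, (x * y) ^ p ^ k = 1) :
    ∃ V : Subgroup G, V.Normal ∧ IsPGroup p V ∧ V ≠ ⊥ := by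
  have : Fact p.Prime := ⟨hp⟩
  let V : Subgroup G :=
    { carrier := {x | ∃ k : ℕ, x ^ p ^ k = 1}
      mul_mem' := by
        rintro x y ⟨i, hi⟩ ⟨j, hj⟩
        exact h x y i j hi hj
      one_mem' := ⟨0, one_pow _⟩
      inv_mem' := by
        rintro x ⟨k, hk⟩
        exact ⟨k, by rw [inv_pow, hk, inv_one]⟩ }
  refine ⟨V, ⟨?_⟩, isPGroup_subgroup_iff.2 fun x hx => hx, ?_⟩
  · rintro x ⟨k, hk⟩ g
    exact ⟨k, by rw [conj_pow, hk, mul_one, mul_inv_cancel]⟩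
  · obtain ⟨x, hx⟩ := exists_prime_orderOf_dvd_card' (G := G) p hdvd
    intro hbot
    have hxV : x ∈ V := ⟨1, by rw [pow_one]; exact orderOf_dvd_iff_pow_eq_one.1 hx.dvd⟩
    rw [hbot, Subgroup.mem_bot] at hxV
    rw [hxV, orderOf_one] at hx
    exact hp.one_lt.ne hx

theorem IsMatroidGroup.isPrimaryByPrimary_closure {G : Type*} [Group G] [Finite G]
    (hG : IsMatroidGroup G) (x y : G) : IsPrimaryByPrimary (Subgroup.closure {x, y}) :=
  isPrimaryByPrimary_of_dependent (hG.hasPrimePowerOrders.subgroup _) (hG.triplesDependent x y)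

/-- A version of `IsPrimaryByPrimary` for a subgroup in terms of subgroups of the whole group. -/
theorem IsPrimaryByPrimary.exists_subgroup {G : Type*} [Group G] {H : Subgroup G}
    (hH : IsPrimaryByPrimary H) :
    ∃ p q : ℕ, p.Prime ∧ q.Prime ∧ p ≠ q ∧ ∃ P ≤ H, IsPGroup p P ∧
      H ≤ Subgroup.normalizer (P : Set G) ∧ (∀ g ∈ H, ∃ k : ℕ, g ^ q ^ k ∈ P) ∧
      ∀ g ∈ H, ∀ k : ℕ, g ^ p ^ k = 1 → g ∈ P := by
  obtain ⟨p, q, hp, hq, hpq, P, hPn, hP, hg⟩ := hH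
  have hg' : ∀ g ∈ H, ∃ k : ℕ, g ^ q ^ k ∈ P.map H.subtype := by
    intro g hgH
    obtain ⟨k, hk⟩ := hg ⟨g, hgH⟩
    exact ⟨k, ⟨_, hk, by simp⟩⟩
  refine ⟨p, q, hp, hq, hpq, P.map H.subtype, Subgroup.map_subtype_le P, hP.map _, ?_, hg', ?_⟩
  · rw [Subgroup.le_normalizer_iff]
    rintro h hh _ ⟨x, hx, rfl⟩
    exact ⟨⟨h, hh⟩ * x * ⟨h, hh⟩⁻¹, hPn.conj_mem x hx _, by simp⟩
  · intro g hgH k hk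
    obtain ⟨l, hl⟩ := hg' g hgH
    exact mem_of_pow_prime_pow_mem hp hq hpq (i := k) (hk ▸ one_mem _) hl

theorem IsMatroidGroup.exists_normalized_isPGroup {G : Type*} [Group G] [Finite G]
    (hG : IsMatroidGroup G) {p : ℕ} (hp : p.Prime) {x y : G} {i j : ℕ} (hx : x ^ p ^ i = 1)
    (hy : y ^ p ^ j = 1) (hxy : ∀ k : ℕ, (x * y) ^ p ^ k ≠ 1) :
    ∃ r : ℕ, r.Prime ∧ p ≠ r ∧ ∃ R : Subgroup G, IsPGroup r R ∧ R ≠ ⊥ ∧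
      (∀ a ∈ R, ∀ b ∈ R, ∀ c ∈ R, a ∈ Subgroup.closure {b, c} ∨
        b ∈ Subgroup.closure {a, c} ∨ c ∈ Subgroup.closure {a, b}) ∧
      ∃ c ∈ Subgroup.normalizer (R : Set G), orderOf c = p := by
  obtain ⟨r, q, hr, hq, hrq, P, hPle, hP, hPn, hg, hmem⟩ :=
    (hG.isPrimaryByPrimary_closure x y).exists_subgroup
  have hxH : x ∈ Subgroup.closure {x, y} := Subgroup.subset_closure (Or.inl rfl)
  have hyH : y ∈ Subgroup.closure {x, y} := Subgroup.subset_closure (Or.inr rfl)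
  have hpr : p ≠ r := by
    rintro rfl
    obtain ⟨k, hk⟩ := isPGroup_subgroup_iff.1 hP _ (mul_mem (hmem x hxH i hx) (hmem y hyH j hy))
    exact hxy k hk
  have hP1 : P ≠ ⊥ := by
    rintro rfl
    have hq1 : ∀ g ∈ Subgroup.closure {x, y}, ∃ k : ℕ, g ^ q ^ k = 1 := hg
    by_cases hqp : q = p
    · subst hqp
      obtain ⟨k, hk⟩ := hq1 _ (mul_mem hxH hyH)
      exact hxy k hk
    · obtain ⟨k, hk⟩ := hq1 x hxH
      obtain ⟨l, hl⟩ := hq1 y hyH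
      refine hxy 0 ?_
      rw [eq_one_of_pow_prime_pow hq hp hqp hk hx, eq_one_of_pow_prime_pow hq hp hqp hl hy,
        mul_one, one_pow]
  refine ⟨r, hr, hpr, P, hP, hP1, fun a ha b hb c hc =>
    hG.dependent (hPle ha) (hPle hb) (hPle hc), ?_⟩
  by_cases hx1 : x = 1
  · have hy1 : y ≠ 1 := fun hy1 => hxy 0 (by rw [hx1, hy1, mul_one, one_pow])
    obtain ⟨n, hn⟩ := exists_orderOf_pow_eq_prime hy1 hp hy
    exact ⟨y ^ n, hPn (pow_mem hyH n), hn⟩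
  · obtain ⟨n, hn⟩ := exists_orderOf_pow_eq_prime hx1 hp hx
    exact ⟨x ^ n, hPn (pow_mem hxH n), hn⟩

theorem HasPrimePowerOrders.conj_eq_inv {G : Type*} [Group G] [Finite G]
    (hG : HasPrimePowerOrders G) {r : ℕ} (hr : r.Prime) (hr2 : r ≠ 2) {R : Subgroup G}
    (hR : IsPGroup r R) {i : G} (hi : i * i = 1) (hi1 : i ≠ 1)
    (hiR : i ∈ Subgroup.normalizer (R : Set G)) {y : G} (hy : y ∈ R) : i * y * i⁻¹ = y⁻¹ := by
  have hii : i⁻¹ = i := inv_eq_of_mul_eq_one_left hi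
  let f : R → R := fun x =>
    ⟨(x : G)⁻¹ * (i * x * i⁻¹), mul_mem (inv_mem x.2) ((Subgroup.mem_normalizer_iff.1 hiR x).1 x.2)⟩
  have hinj : Function.Injective f := by
    intro x z hxz
    have h1 : (x : G)⁻¹ * (i * x * i⁻¹) = (z : G)⁻¹ * (i * z * i⁻¹) := congrArg Subtype.val hxz
    have h2 : Commute i (z * (x : G)⁻¹) := by
      have : i * (z * (x : G)⁻¹) * i⁻¹ = z * (x : G)⁻¹ := by
        calc i * (z * (x : G)⁻¹) * i⁻¹
            = z * ((z : G)⁻¹ * (i * z * i⁻¹)) * (i * x * i⁻¹)⁻¹ := by group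
          _ = z * (x : G)⁻¹ := by rw [← h1]; group
      exact mul_inv_eq_iff_eq_mul.1 this
    obtain ⟨k, hk⟩ := isPGroup_subgroup_iff.1 hR _ (mul_mem z.2 (inv_mem x.2))
    have h3 := (hG Nat.prime_two hr hr2.symm i _ 1 k h2 (by rw [pow_one, sq, hi]) hk).resolve_left
      hi1
    exact Subtype.ext (mul_inv_eq_one.1 h3).symm
  obtain ⟨x, hx⟩ := Finite.surjective_of_injective hinj ⟨y, hy⟩
  have hx' : (x : G)⁻¹ * (i * x * i⁻¹) = y := congrArg Subtype.val hx
  rw [← hx', hii, mul_inv_rev, inv_inv, mul_inv_rev, mul_inv_rev, hii]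
  calc i * ((x : G)⁻¹ * (i * x * i)) * i = i * ((x : G)⁻¹ * i * x * (i * i)) := by group
    _ = i * ((x : G)⁻¹ * i) * x := by rw [hi]; group

/-- If some involution commutes with a further involution, then all of them do. -/
theorem HasPrimePowerOrders.exists_commuting_involution {G : Type*} [Group G] [Finite G]
    (hG : HasPrimePowerOrders G) {a b i : G} (ha : a * a = 1) (hb : b * b = 1) (hb1 : b ≠ 1)
    (ha1 : a ≠ 1) (hne : a ≠ b) (hab : Commute a b) (hi : i * i = 1) :
    ∃ c : G, c * c = 1 ∧ c ≠ 1 ∧ c ≠ i ∧ Commute i c := by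
  by_cases hai : a = i
  · subst hai
    exact ⟨b, hb, hb1, hne.symm, hab⟩
  have hii : i⁻¹ = i := inv_eq_of_mul_eq_one_left hi
  have haa : a⁻¹ = a := inv_eq_of_mul_eq_one_left ha
  have hconj : i * (i * a) * i⁻¹ = (i * a)⁻¹ := by
    rw [mul_inv_rev, hii, haa, ← mul_assoc, hi, one_mul]
  have hw1 : i * a ≠ 1 := fun h => hai ((eq_inv_of_mul_eq_one_right h).trans hii)
  have hia : i * (i * a) = a := by rw [← mul_assoc, hi, one_mul]
  obtain ⟨t, ht, k, hk⟩ := hG.exists_pow_eq_one (i * a)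
  by_cases ht2 : t = 2
  · subst ht2
    obtain ⟨j, hj⟩ := exists_orderOf_pow_eq_prime hw1 ht hk
    set z := (i * a) ^ j with hz
    have hzz : z * z = 1 := by rw [← sq]; exact orderOf_dvd_iff_pow_eq_one.1 hj.dvd
    have hz1 : z ≠ 1 := fun h => by rw [h, orderOf_one] at hj; omega
    by_cases hzi : z = i
    · have h1 : Commute i (i * a) := by
        have h2 : Commute z (i * a) := (Commute.refl (i * a)).pow_left j
        rwa [hzi] at h2
      refine ⟨a, ha, ha1, hai, ?_⟩
      have := (Commute.refl i).mul_right h1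
      rwa [hia] at this
    · refine ⟨z, hzz, hz1, hzi, ?_⟩
      have : i * z * i⁻¹ = z := by
        rw [hz, ← conj_pow, hconj, inv_pow, ← hz]
        exact inv_eq_of_mul_eq_one_left hzz
      exact mul_inv_eq_iff_eq_mul.1 this
  · obtain ⟨m, hm⟩ : Odd (t ^ k) := (ht.odd_of_ne_two ht2).pow
    set g := (i * a) ^ m with hg
    have hg2 : g * g * (i * a) = 1 := by
      rw [← hk, hm, hg, pow_succ, two_mul, pow_add]
    have higi : i * g⁻¹ * i⁻¹ = g := by
      have : i * g * i⁻¹ = g⁻¹ := by rw [hg, ← conj_pow, hconj, inv_pow]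
      rw [← conj_inv, this, inv_inv]
    have hgi : g⁻¹ * a * g = i := by
      have h1 : a = g * g * i := by
        have h2 : a = (g * g * i)⁻¹ := by
          rw [← mul_assoc] at hg2
          exact eq_inv_of_mul_eq_one_right hg2
        have h3 : a⁻¹ = g * g * i := by rw [h2, inv_inv]
        rw [← haa, h3]
      have h4 : i * g⁻¹ = g * i := mul_inv_eq_iff_eq_mul.1 higi
      have h5 : i = g * i * g := by rw [← h4, inv_mul_cancel_right]
      rw [h1]
      calc g⁻¹ * (g * g * i) * g = g * i * g := by group
        _ = i := h5.symm
    refine ⟨g⁻¹ * b * g, ?_, ?_, ?_, ?_⟩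
    · calc g⁻¹ * b * g * (g⁻¹ * b * g) = g⁻¹ * (b * b) * g := by group
        _ = 1 := by rw [hb]; group
    · intro h
      refine hb1 ?_
      calc b = g * (g⁻¹ * b * g) * g⁻¹ := by group
        _ = 1 := by rw [h]; group
    · intro h
      refine hne ?_
      rw [← hgi, mul_left_inj, mul_right_inj] at h
      exact h.symm
    · rw [← hgi]
      have := hab.map (MulAut.conj g⁻¹)
      simpa using this

theorem mem_normalizer_of_involution {G : Type*} [Group G] {P : Subgroup G} {i : G} (hi : i * i = 1)
    (h : ∀ x ∈ P, i * x * i⁻¹ ∈ P) : i ∈ Subgroup.normalizer (P : Set G) := by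
  rw [Subgroup.mem_normalizer_iff]
  refine fun x => ⟨h x, fun hx => ?_⟩
  have hii : i⁻¹ = i := inv_eq_of_mul_eq_one_left hi
  have h1 := h _ hx
  have h2 : i * (i * x * i⁻¹) * i⁻¹ = x := by
    rw [hii]
    calc i * (i * x * i) * i = (i * i) * x * (i * i) := by group
      _ = x := by rw [hi, one_mul, mul_one]
  rwa [h2] at h1

theorem IsMatroidGroup.false_of_commuting_involutions {G : Type*} [Group G] [Finite G]
    (hG : IsMatroidGroup G) {i c s : G} (hi : i * i = 1) (hi1 : i ≠ 1) (hc : c * c = 1)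
    (hc1 : c ≠ 1) (hci : c ≠ i) (hic : Commute i c) (hs : s ^ 3 = 1) (hs1 : s ≠ 1)
    (his : i * s * i⁻¹ = s⁻¹) : False := by
  have hE := hG.hasPrimePowerOrders
  have hii : i⁻¹ = i := inv_eq_of_mul_eq_one_left hi
  have hcs : ∀ u : G, u * u = 1 → Commute u s → u = 1 := fun u hu hus =>
    (hE Nat.prime_two Nat.prime_three (by decide) u s 1 1 hus (by rw [pow_one, sq, hu])
      (by rw [pow_one, hs])).resolve_right hs1
  obtain ⟨p, q, hp, hq, hpq, P, hPle, hP, hPn, hg, hmem⟩ :=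
    (hG.isPrimaryByPrimary_closure c s).exists_subgroup
  set H := Subgroup.closure {c, s} with hH
  have hcH : c ∈ H := Subgroup.subset_closure (Or.inl rfl)
  have hsH : s ∈ H := Subgroup.subset_closure (Or.inr rfl)
  have hp3 : p ≠ 3 := by
    rintro rfl
    have hsP : s ∈ P := hmem s hsH 1 (by rw [pow_one, hs])
    have h1 := hE.conj_eq_inv hp (by decide) hP hc hc1 (hPn hcH) hsP
    have h2 : Commute (i * c) s := by
      refine mul_inv_eq_iff_eq_mul.1 ?_
      calc i * c * s * (i * c)⁻¹ = i * (c * s * c⁻¹) * i⁻¹ := by group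
        _ = s := by rw [h1, ← conj_inv, his, inv_inv]
    have h3 := hcs (i * c)
      (by rw [mul_assoc, ← mul_assoc c, ← hic.eq, mul_assoc i, hc, mul_one, hi]) h2
    exact hci ((eq_inv_of_mul_eq_one_right h3).trans hii)
  have hsP : s ∉ P := by
    intro hsP
    obtain ⟨k, hk⟩ := isPGroup_subgroup_iff.1 hP s hsP
    exact hs1 (eq_one_of_pow_prime_pow hp Nat.prime_three hp3 hk (j := 1) (by rw [pow_one, hs]))
  have hq3 : q = 3 := by
    by_contra hq3
    obtain ⟨k, hk⟩ := hg s hsH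
    exact hsP (mem_of_pow_prime_pow_mem hq Nat.prime_three hq3 hk (j := 1)
      (by rw [pow_one, hs]; exact one_mem _))
  subst hq3
  have hcP : c ∈ P := by
    obtain ⟨k, hk⟩ := hg c hcH
    exact mem_of_pow_prime_pow_mem Nat.prime_two hq (by decide) (i := 1)
      (by rw [pow_one, sq, hc]; exact one_mem _) hk
  have hp2 : p = 2 := by
    by_contra hp2
    obtain ⟨k, hk⟩ := isPGroup_subgroup_iff.1 hP c hcP
    exact hc1 (eq_one_of_pow_prime_pow hp Nat.prime_two hp2 hk (j := 1) (by rw [pow_one, sq, hc]))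
  subst hp2
  have hiP : i ∉ P := by
    intro hiP
    have h1 : s * i * s⁻¹ * i⁻¹ ∈ P :=
      mul_mem ((Subgroup.mem_normalizer_iff.1 (hPn hsH) i).1 hiP) (inv_mem hiP)
    have h2 : s * i * s⁻¹ * i⁻¹ = s * s := by
      calc s * i * s⁻¹ * i⁻¹ = s * (i * s⁻¹ * i⁻¹) := by group
        _ = s * s := by rw [← conj_inv, his, inv_inv]
    rw [h2] at h1
    refine hsP ?_
    have h3 := mul_mem h1 h1
    have h4 : s * s * (s * s) = s := by
      calc s * s * (s * s) = s ^ 3 * s := by rw [pow_three]; group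
        _ = s := by rw [hs, one_mul]
    rwa [h4] at h3
  have hiH : ∀ x ∈ H, i * x * i⁻¹ ∈ H := by
    have : H ≤ H.comap (MulAut.conj i).toMonoidHom := by
      rw [hH, Subgroup.closure_le]
      rintro x (rfl | rfl)
      · have : i * x * i⁻¹ = x := mul_inv_eq_iff_eq_mul.2 hic
        simpa [this] using hcH
      · simpa [his] using hsH
    intro x hx
    simpa using this hx
  have hiPn : i ∈ Subgroup.normalizer (P : Set G) := by
    refine mem_normalizer_of_involution hi fun x hx => ?_
    obtain ⟨k, hk⟩ := isPGroup_subgroup_iff.1 hP x hx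
    exact hmem _ (hiH x (hPle hx)) k (by rw [conj_pow, hk, mul_one, mul_inv_cancel])
  have hP1 : P ≠ ⊥ := by
    rintro rfl
    exact hc1 hcP
  obtain ⟨z, hz, hz1, hiz⟩ : ∃ z ∈ omegaCenter 2 P, z ≠ 1 ∧ i * z * i⁻¹ = z := by
    by_contra! h
    have h1 := card_modEq_one_of_fixedPointFree Nat.prime_two (by rw [sq, hi])
      (fun x hx => conj_mem_omegaCenter hiPn hx)
      (fun x hx hx' => by_contra fun hx1 => h x hx hx1 hx')
    have : Fact (Nat.Prime 2) := ⟨Nat.prime_two⟩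
    obtain ⟨n, hn, hcard⟩ := (isPGroup_omegaCenter (r := 2) (R := P)).nontrivial_iff_card.1
      ((Subgroup.nontrivial_iff_ne_bot _).2 (omegaCenter_ne_bot Nat.prime_two hP hP1))
    rw [hcard] at h1
    have h2 : 2 ∣ 2 ^ n := dvd_pow_self 2 hn.ne'
    unfold Nat.ModEq at h1
    omega
  have hzz : z * z = 1 := by rw [← sq]; exact hz.2.2
  set z₁ := s * z * s⁻¹ with hz₁
  set z₂ := s⁻¹ * z * s with hz₂
  have hz₁V : z₁ ∈ omegaCenter 2 P := conj_mem_omegaCenter (hPn hsH) hz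
  have hz₂V : z₂ ∈ omegaCenter 2 P := by
    have := conj_mem_omegaCenter (inv_mem (hPn hsH)) hz
    rwa [inv_inv] at this
  have hss : s * s = s⁻¹ := eq_inv_of_mul_eq_one_left (by rw [← hs, pow_three, mul_assoc])
  have hprod : z * z₁ * z₂ = 1 := by
    refine hcs _ ?_ (Commute.symm (mul_inv_eq_iff_eq_mul.1 ?_))
    · rw [← sq]
      exact (mul_mem (mul_mem hz hz₁V) hz₂V).2.2
    · have h1 : s * z₁ * s⁻¹ = z₂ := by
        calc s * z₁ * s⁻¹ = (s * s) * z * (s * s)⁻¹ := by rw [hz₁]; group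
          _ = z₂ := by rw [hss, inv_inv]
      calc s * (z * z₁ * z₂) * s⁻¹ = (s * z * s⁻¹) * (s * z₁ * s⁻¹) * (s * z₂ * s⁻¹) := by group
        _ = z₁ * z₂ * z := by rw [h1, ← hz₁, hz₂]; group
        _ = z * z₁ * z₂ := by
          rw [mul_assoc z]
          exact (hz.2.1 _ (omegaCenter_le (mul_mem hz₁V hz₂V))).eq.symm
  have hz₂₁ : z₂ * z₁ = z := by
    have h1 : z₁ * z₂ = z⁻¹ := eq_inv_of_mul_eq_one_right (by rw [← mul_assoc, hprod])
    rw [(hz₂V.2.1 _ (omegaCenter_le hz₁V)).eq, h1]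
    exact inv_eq_of_mul_eq_one_left hzz
  have hiz₁ : i * z₁ * i⁻¹ = z₂ := by
    calc i * z₁ * i⁻¹ = (i * s * i⁻¹) * (i * z * i⁻¹) * (i * s * i⁻¹)⁻¹ := by rw [hz₁]; group
      _ = z₂ := by rw [his, hiz, inv_inv]
  have hzi : Commute i z := mul_inv_eq_iff_eq_mul.1 hiz
  have hx : i * z₁ * (i * z₁) = z := by
    rw [← hz₂₁, ← hiz₁, hii]
    group
  have hxC : i * z₁ ∈ Subgroup.closure {i * z₁, s} := Subgroup.subset_closure (Or.inl rfl)
  have hsC : s ∈ Subgroup.closure {i * z₁, s} := Subgroup.subset_closure (Or.inr rfl)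
  have hzC : z ∈ Subgroup.closure {i * z₁, s} := by
    have := mul_mem hxC hxC
    rwa [hx] at this
  have hiC : i ∈ Subgroup.closure {i * z₁, s} := by
    have := mul_mem hxC (inv_mem (mul_mem (mul_mem hsC hzC) (inv_mem hsC)))
    rwa [← hz₁, mul_inv_cancel_right] at this
  rcases hG.dependent hzC hsC hiC with h | h | h
  · have hin : i ∈ Subgroup.normalizer (Subgroup.zpowers s : Set G) := by
      refine mem_normalizer_of_involution hi ?_
      rintro _ ⟨k, rfl⟩
      exact ⟨-k, by simp only; rw [← conj_zpow, his, inv_zpow, zpow_neg]⟩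
    obtain ⟨v, hv, j, hj⟩ := exists_mul_zpow_of_mem_sup hin
      (closure_pair_le_sup_zpowers (Subgroup.mem_zpowers s) h)
    have hvs : Commute v s := by
      obtain ⟨k, rfl⟩ := hv
      exact (Commute.refl s).zpow_left k
    rcases Int.even_or_odd' j with ⟨m, rfl | rfl⟩
    · rw [zpow_mul, zpow_ofNat, sq, hi, one_zpow, mul_one] at hj
      subst hj
      exact hz1 (hcs _ hzz hvs)
    · rw [zpow_add, zpow_mul, zpow_ofNat, sq, hi, one_zpow, one_mul, zpow_one] at hj
      have hv' : v = z * i := by rw [← hj, mul_assoc, hi, mul_one]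
      have hv1 : v = 1 := hcs v (by
        rw [hv', mul_assoc, ← mul_assoc i, hzi.eq, mul_assoc z, hi, mul_one, hzz]) hvs
      rw [hv1, one_mul] at hj
      exact hiP (hj ▸ hz.1)
  · have h1 : Subgroup.closure {z, i} ≤ Subgroup.centralizer {i} := by
      rw [Subgroup.closure_le]
      rintro x (rfl | rfl)
      · exact Subgroup.mem_centralizer_singleton_iff.2 hzi.symm
      · exact Subgroup.mem_centralizer_singleton_iff.2 rfl
    have h2 : Commute s i := Subgroup.mem_centralizer_singleton_iff.1 (h1 h)
    exact hi1 (hcs i hi h2.symm)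
  · refine hiP (hmem i ?_ 1 (by rw [pow_one, sq, hi]))
    refine (Subgroup.closure_le _).2 ?_ h
    rintro x (rfl | rfl)
    · exact hPle hz.1
    · exact hsH

/-- A nontrivial matroid group has a nontrivial normal primary subgroup. -/
theorem IsMatroidGroup.exists_normal_isPGroup {G : Type*} [Group G] [Finite G] [Nontrivial G]
    (hG : IsMatroidGroup G) :
    ∃ (p : ℕ) (V : Subgroup G), p.Prime ∧ V.Normal ∧ IsPGroup p V ∧ V ≠ ⊥ := by
  by_contra! hno
  have hE := hG.hasPrimePowerOrders
  have hmul : ∀ p : ℕ, p.Prime → p ∣ Nat.card G → ∃ (x y : G) (i j : ℕ), x ^ p ^ i = 1 ∧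
      y ^ p ^ j = 1 ∧ ∀ k : ℕ, (x * y) ^ p ^ k ≠ 1 := by
    intro p hp hpG
    by_contra! h
    obtain ⟨V, hV, hVp, hV1⟩ := exists_normal_isPGroup_of_mul_closed hp hpG h
    exact hV1 (hno p V hp hV hVp)
  have hdvd : ∀ {r : ℕ} {R : Subgroup G}, r.Prime → IsPGroup r R → R ≠ ⊥ → r ∣ Nat.card G := by
    intro r R hr hR hR1
    have : Fact r.Prime := ⟨hr⟩
    obtain ⟨n, hn, hcard⟩ := hR.nontrivial_iff_card.1 ((Subgroup.nontrivial_iff_ne_bot _).2 hR1)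
    exact ((dvd_pow_self r hn.ne').trans hcard.symm.dvd).trans R.card_subgroup_dvd_card
  have hcard : Nat.card G ≠ 1 := Finite.one_lt_card.ne'
  obtain ⟨p, hpmem, hmax⟩ := (Nat.card G).primeFactors.exists_max_image id
    ⟨_, Nat.mem_primeFactors.2 ⟨Nat.minFac_prime hcard, Nat.minFac_dvd _, Nat.card_pos.ne'⟩⟩
  have hp := Nat.prime_of_mem_primeFactors hpmem
  have hle : ∀ {r : ℕ} {R : Subgroup G}, r.Prime → IsPGroup r R → R ≠ ⊥ → r ≤ p :=
    fun hr hR hR1 => hmax _ (Nat.mem_primeFactors.2 ⟨hr, hdvd hr hR hR1, Nat.card_pos.ne'⟩)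
  obtain ⟨x, y, i, j, hx, hy, hxy⟩ := hmul p hp (Nat.dvd_of_mem_primeFactors hpmem)
  obtain ⟨r, hr, hpr, R, hR, hR1, hdep, c, hcR, hc⟩ :=
    hG.exists_normalized_isPGroup hp hx hy hxy
  rcases prime_lt_or_of_mem_normalizer hE hr hp hpr hR hR1 hdep hc hcR with h |
    ⟨rfl, rfl, a, -, b, -, ha1, hb1, hab, ha, hb, hcomm⟩
  · exact h.not_ge (hle hr hR hR1)
  obtain ⟨x, y, i, j, hx, hy, hxy⟩ := hmul 2 hr (hdvd hr hR hR1)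
  obtain ⟨r, hr', h2r, R', hR', hR1', -, i, hiR, hi⟩ :=
    hG.exists_normalized_isPGroup hr hx hy hxy
  have hr3 : r = 3 := by
    have h1 := hle hr' hR' hR1'
    have h2 := hr'.two_le
    omega
  subst hr3
  have hii : i * i = 1 := by rw [← sq]; exact orderOf_dvd_iff_pow_eq_one.1 hi.dvd
  have hi1 : i ≠ 1 := by
    rintro rfl
    rw [orderOf_one] at hi
    omega
  obtain ⟨s, hs, hs1⟩ := exists_mem_ne_one (omegaCenter_ne_bot hr' hR' hR1')
  obtain ⟨c, hc, hc1, hci, hic⟩ :=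
    hE.exists_commuting_involution ha hb hb1 ha1 hab hcomm hii
  exact hG.false_of_commuting_involutions hii hi1 hc hc1 hci hic hs.2.2 hs1
    (hE.conj_eq_inv hr' (by decide) hR' hii hi1 hiR hs.1)

/-! ### The structure of matroid groups -/

theorem Subgroup.normal_inf_of_sup_eq_top {G : Type*} [Group G] {B V W : Subgroup G} (hV : V.Normal)
    (hVW : ∀ x ∈ V, ∀ w ∈ W, Commute x w) (h : B ⊔ W = ⊤) : (B ⊓ V).Normal := by
  rw [← Subgroup.normalizer_eq_top_iff, ← top_le_iff, ← h, sup_le_iff,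
    Subgroup.le_normalizer_iff, Subgroup.le_normalizer_iff]
  constructor
  · rintro b hb x ⟨hxB, hxV⟩
    exact ⟨B.mul_mem (B.mul_mem hb hxB) (B.inv_mem hb), hV.conj_mem x hxV b⟩
  · rintro w hw x ⟨hxB, hxV⟩
    rw [← (hVW x hxV w hw).eq, mul_inv_cancel_right]
    exact ⟨hxB, hxV⟩

/-- The generators of the normal subgroups of order `p`. -/
def normalPrimeSet (G : Type*) [Group G] (p : ℕ) : Set G :=
  {t | t ≠ 1 ∧ t ^ p = 1 ∧ (Subgroup.zpowers t).Normal}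

theorem IsMatroidGroup.exists_mem_normalPrimeSet {G : Type*} [Group G] [Finite G]
    (hG : IsMatroidGroup G) {p : ℕ} (hp : p.Prime) {N : Subgroup G} (hN : N.Normal)
    (hNp : IsPGroup p N) (hN1 : N ≠ ⊥) : ∃ t ∈ N, t ∈ normalPrimeSet G p := by
  obtain ⟨V, ⟨hV, hVN, hV1⟩, hmin⟩ := (Set.toFinite
    {V : Subgroup G | V.Normal ∧ V ≤ N ∧ V ≠ ⊥}).exists_minimal ⟨N, hN, le_rfl, hN1⟩
  have hVp : IsPGroup p V := hNp.to_le hVN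
  have hVo : V ≤ omegaCenter p V := by
    refine hmin ⟨⟨fun x hx g => ?_⟩, omegaCenter_le.trans hVN, omegaCenter_ne_bot hp hVp hV1⟩
      omegaCenter_le
    refine conj_mem_omegaCenter ?_ hx
    rw [Subgroup.normalizer_eq_top]
    trivial
  obtain ⟨v, hv, hv1⟩ := exists_mem_ne_one hV1
  suffices V = Subgroup.zpowers v from ⟨v, hVN hv, hv1, (hVo hv).2.2, this ▸ hV⟩
  refine le_antisymm (fun w hw => ?_) (Subgroup.zpowers_le.2 hv)
  by_contra hwv
  have hvw : v ∉ Subgroup.zpowers w := by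
    rintro ⟨k, rfl⟩
    exact hwv (mem_zpowers_of_zpow_ne_one hp (hVo hw).2.2 hv1)
  have hne : v ≠ w := by
    rintro rfl
    exact hwv (Subgroup.mem_zpowers v)
  have hind : IsIndepSet {v, w} := by
    rw [isIndepSet_iff]
    rintro x (rfl | rfl) hmem
    · refine hvw (Subgroup.zpowers_eq_closure w ▸ Subgroup.closure_mono ?_ hmem)
      rintro y ⟨rfl | rfl, hy⟩
      · exact absurd rfl hy
      · rfl
    · refine hwv (Subgroup.zpowers_eq_closure v ▸ Subgroup.closure_mono ?_ hmem)
      rintro y ⟨rfl | rfl, hy⟩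
      · rfl
      · exact absurd rfl hy
  obtain ⟨Z, hZ, hZmin⟩ := hG.2 _ hind
  obtain ⟨hZtop, hZind⟩ := isMinimalGenSet_iff.1 hZmin
  refine isIndepSet_iff.1 hZind w (hZ (Or.inr rfl)) ?_
  have hB : Subgroup.closure (Z \ {w}) ⊔ V = ⊤ := by
    rw [← top_le_iff, ← hZtop, Subgroup.closure_le]
    intro x hx
    by_cases hxw : x = w
    · exact Subgroup.mem_sup_right (hxw ▸ hw)
    · exact Subgroup.mem_sup_left (Subgroup.subset_closure ⟨hx, hxw⟩)
  have hn := Subgroup.normal_inf_of_sup_eq_top hV (fun x hx y hy => (hVo hx).2.1 y hy) hB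
  have hvB : v ∈ Subgroup.closure (Z \ {w}) ⊓ V :=
    ⟨Subgroup.subset_closure ⟨hZ (Or.inl rfl), hne⟩, hv⟩
  exact (hmin ⟨hn, inf_le_right.trans hVN, fun h => hv1 (by rwa [h, Subgroup.mem_bot] at hvB)⟩
    inf_le_right hw).1

theorem exists_conj_eq_pow {G : Type*} [Group G] [Finite G] {a : G}
    (ha : (Subgroup.zpowers a).Normal) (x : G) : ∃ k : ℕ, x * a * x⁻¹ = a ^ k := by
  obtain ⟨k, hk⟩ := mem_powers_iff_mem_zpowers.2 (ha.conj_mem a (Subgroup.mem_zpowers a) x)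
  exact ⟨k, hk.symm⟩

theorem pow_eq_pow_of_natCast_eq {G : Type*} [Group G] {p : ℕ} {a : G} (ha : a ^ p = 1) {k l : ℕ}
    (h : (k : ZMod p) = l) : a ^ k = a ^ l :=
  pow_eq_pow_iff_modEq.2 (((ZMod.natCast_eq_natCast_iff _ _ _).1 h).of_dvd
    (orderOf_dvd_of_pow_eq_one ha))

theorem commute_of_mem_normalPrimeSet {G : Type*} [Group G] [Finite G] {p : ℕ} (hp : p.Prime)
    {a x : G} (ha : a ∈ normalPrimeSet G p) {j : ℕ} (hx : x ^ p ^ j = 1) : Commute x a := by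
  have : Fact p.Prime := ⟨hp⟩
  obtain ⟨k, hk⟩ := exists_conj_eq_pow ha.2.2 x
  have hiter : ∀ m : ℕ, x ^ m * a * (x ^ m)⁻¹ = a ^ k ^ m := by
    intro m
    induction m with
    | zero => simp
    | succ m ih =>
      calc x ^ (m + 1) * a * (x ^ (m + 1))⁻¹ = x ^ m * (x * a * x⁻¹) * (x ^ m)⁻¹ := by group
        _ = a ^ k ^ (m + 1) := by rw [hk, ← conj_pow, ih, ← pow_mul, pow_succ]
  have h1 := hiter (p ^ j)
  rw [hx, one_mul, inv_one, mul_one] at h1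
  have h2 : a ^ k ^ p ^ j = a ^ k :=
    pow_eq_pow_of_natCast_eq ha.2.1 (by push_cast; exact ZMod.pow_card_pow _)
  exact mul_inv_eq_iff_eq_mul.1 (by rw [hk, ← h2, ← h1])

theorem closure_normal_of_subset_normalPrimeSet {G : Type*} [Group G] {p : ℕ} {D : Set G}
    (hD : D ⊆ normalPrimeSet G p) : (Subgroup.closure D).Normal := by
  refine ⟨fun x hx g => ?_⟩
  have : Subgroup.closure D ≤ (Subgroup.closure D).comap (MulAut.conj g).toMonoidHom := by
    rw [Subgroup.closure_le]
    intro a ha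
    exact (Subgroup.zpowers_le.2 (Subgroup.subset_closure ha))
      ((hD ha).2.2.conj_mem a (Subgroup.mem_zpowers a) g)
  exact this hx

/-- The Steinitz exchange for independent sets of generators of normal subgroups of order `p`. -/
theorem exists_mem_closure_sup_zpowers {G : Type*} [Group G] [Finite G] {p : ℕ} (hp : p.Prime)
    {A : Set G} (hA : A ⊆ normalPrimeSet G p) {t : G} (ht1 : t ≠ 1)
    (ht : t ∈ Subgroup.closure A) :
    ∃ a ∈ A, a ∈ Subgroup.closure (A \ {a}) ⊔ Subgroup.zpowers t := by
  obtain ⟨B, ⟨hBA, htB⟩, hmin⟩ := (Set.toFinite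
    {B : Set G | B ⊆ A ∧ t ∈ Subgroup.closure B}).exists_minimal ⟨A, subset_rfl, ht⟩
  obtain ⟨a, ha⟩ : B.Nonempty := by
    rw [Set.nonempty_iff_ne_empty]
    rintro rfl
    rw [Subgroup.closure_empty, Subgroup.mem_bot] at htB
    exact ht1 htB
  have htB' : t ∉ Subgroup.closure (B \ {a}) := fun h =>
    (hmin ⟨Set.sdiff_subset.trans hBA, h⟩ Set.sdiff_subset ha).2 rfl
  refine ⟨a, hBA ha, ?_⟩
  refine sup_le_sup_right (Subgroup.closure_mono (Set.sdiff_subset_sdiff_left hBA)) _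
    (exchange_of_normal hp (hA (hBA ha)).2.1
      (Or.inr (closure_normal_of_subset_normalPrimeSet (Set.sdiff_subset.trans (hBA.trans hA))))
      ?_ htB')
  rwa [← closure_insert_eq_sup_zpowers, Set.insert_sdiff_singleton, Set.insert_eq_of_mem ha]

theorem IsMatroidGroup.isPGroup_centralizer {G : Type*} [Group G] [Finite G]
    (hG : IsMatroidGroup G) {p : ℕ} (hp : p.Prime) {n : G} (hn : n ∈ normalPrimeSet G p) :
    IsPGroup p (Subgroup.centralizer (Subgroup.zpowers n : Set G)) := by
  refine isPGroup_subgroup_iff.2 fun x hx => ?_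
  have hnx : Commute n x := Subgroup.mem_centralizer_iff.1 hx n (Subgroup.mem_zpowers n)
  obtain ⟨r, hr, k, hk⟩ := hG.hasPrimePowerOrders.exists_pow_eq_one x
  by_cases hpr : p = r
  · exact ⟨k, hpr ▸ hk⟩
  · exact ⟨0, by rw [(hG.hasPrimePowerOrders hp hr hpr n x 1 k hnx (by rw [pow_one, hn.2.1])
      hk).resolve_left hn.1, one_pow]⟩

theorem IsMatroidGroup.exists_complement {G : Type*} [Group G] [Finite G]
    (hG : IsMatroidGroup G) {p : ℕ} (hp : p.Prime) {n : G} (hn : n ∈ normalPrimeSet G p) :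
    ∃ (A : Set G) (P L : Subgroup G), P = Subgroup.centralizer (Subgroup.zpowers n : Set G) ∧
      P.Normal ∧ A ⊆ normalPrimeSet G p ∧ IsIndepSet A ∧ Subgroup.closure A = P ∧
      P ≤ omegaCenter p P ∧ L ⊔ P = ⊤ ∧ L ⊓ P = ⊥ := by
  have := hn.2.2
  set P := Subgroup.centralizer (Subgroup.zpowers n : Set G) with hPdef
  have hPn : P.Normal := by rw [hPdef]; infer_instance
  have hPp : IsPGroup p P := hG.isPGroup_centralizer hp hn
  have hPc : ∀ x ∈ P, ∀ a ∈ normalPrimeSet G p, Commute x a := fun x hx a ha => by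
    obtain ⟨k, hk⟩ := isPGroup_subgroup_iff.1 hPp x hx
    exact commute_of_mem_normalPrimeSet hp ha hk
  have hTP : normalPrimeSet G p ⊆ P := fun a ha => by
    rw [SetLike.mem_coe, hPdef, Subgroup.mem_centralizer_iff]
    rintro _ ⟨k, rfl⟩
    exact (Commute.zpow_left (commute_of_mem_normalPrimeSet hp ha (j := 1)
      (by rw [pow_one, hn.2.1])) k).eq
  have hTo : Subgroup.closure (normalPrimeSet G p) ≤ omegaCenter p P :=
    (Subgroup.closure_le _).2 fun a ha => ⟨hTP ha, fun x hx => (hPc x hx a ha).symm, ha.2.1⟩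
  obtain ⟨A, hAT, hA, hcl⟩ := exists_indep_subset_closure_eq (normalPrimeSet G p)
  obtain ⟨Z, hAZ, hZmin⟩ := hG.2 _ hA
  obtain ⟨hZtop, hZind⟩ := isMinimalGenSet_iff.1 hZmin
  have hLA : Subgroup.closure (Z \ A) ⊔ Subgroup.closure A = ⊤ := by
    rw [← Subgroup.closure_union, Set.sdiff_union_of_subset hAZ, hZtop]
  have hAo : Subgroup.closure A ≤ omegaCenter p P := hcl ▸ hTo
  have hLP : Subgroup.closure (Z \ A) ⊓ P = ⊥ := by
    by_contra hne
    obtain ⟨t, ht, htT⟩ := hG.exists_mem_normalPrimeSet hp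
      (Subgroup.normal_inf_of_sup_eq_top hPn (fun x hx w hw => ((hAo hw).2.1 x hx).symm) hLA)
      (hPp.to_le inf_le_right) hne
    obtain ⟨a, haA, ha⟩ := exists_mem_closure_sup_zpowers hp hAT htT.1
      (hcl ▸ Subgroup.subset_closure htT)
    refine isIndepSet_iff.1 hZind a (hAZ haA)
      ((sup_le ?_ ?_ : _ ≤ Subgroup.closure (Z \ {a})) ha)
    · exact Subgroup.closure_mono (Set.sdiff_subset_sdiff_left hAZ)
    · exact Subgroup.zpowers_le.2 (Subgroup.closure_mono
        (Set.sdiff_subset_sdiff_right (Set.singleton_subset_iff.2 haA)) ht.1)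
  have hAP : Subgroup.closure A = P := by
    refine le_antisymm (hAo.trans omegaCenter_le) fun x hx => ?_
    have hAn := closure_normal_of_subset_normalPrimeSet hAT
    obtain ⟨l, hl, w, hw, rfl⟩ := Subgroup.mem_sup_of_normal_right.1
      (hLA ▸ Subgroup.mem_top x : x ∈ Subgroup.closure (Z \ A) ⊔ Subgroup.closure A)
    have hl1 : l ∈ Subgroup.closure (Z \ A) ⊓ P :=
      ⟨hl, (Subgroup.mul_mem_cancel_right _ (omegaCenter_le (hAo hw))).1 hx⟩
    rw [hLP, Subgroup.mem_bot] at hl1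
    rwa [hl1, one_mul]
  exact ⟨A, P, Subgroup.closure (Z \ A), rfl, hPn, hAT, hA, hAP, hAP ▸ hAo, hAP ▸ hLA, hLP⟩

theorem exists_unitsHom_of_mem_normalPrimeSet {G : Type*} [Group G] [Finite G] {p : ℕ}
    (hp : p.Prime) {n : G} (hn : n ∈ normalPrimeSet G p) :
    ∃ χ : G →* (ZMod p)ˣ, ∀ g, g * n * g⁻¹ = n ^ (χ g : ZMod p).val := by
  have : Fact p.Prime := ⟨hp⟩
  have hord : orderOf n = p := orderOf_eq_prime hn.2.1 hn.1
  choose k hk using exists_conj_eq_pow hn.2.2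
  have hcast : ∀ {i j : ℕ}, n ^ i = n ^ j → (i : ZMod p) = j := fun h =>
    (ZMod.natCast_eq_natCast_iff _ _ _).2 (hord ▸ pow_eq_pow_iff_modEq.1 h)
  let f : G →* ZMod p :=
    { toFun := fun g => k g
      map_one' := by
        rw [← Nat.cast_one]
        exact hcast (by rw [← hk, one_mul, inv_one, mul_one, pow_one])
      map_mul' := fun g h => by
        rw [← Nat.cast_mul]
        refine hcast ?_
        calc n ^ k (g * h) = g * (h * n * h⁻¹) * g⁻¹ := by rw [← hk]; group
          _ = n ^ (k g * k h) := by rw [hk, ← conj_pow, hk, ← pow_mul] }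
  refine ⟨f.toHomUnits, fun g => ?_⟩
  rw [MonoidHom.coe_toHomUnits, hk]
  exact pow_eq_pow_of_natCast_eq hn.2.1 (by rw [ZMod.natCast_val, ZMod.cast_id]; rfl)

theorem IsMatroidGroup.conj_eq_pow_of_mem_normalPrimeSet {G : Type*} [Group G] [Finite G]
    (hG : IsMatroidGroup G) {p : ℕ} (hp : p.Prime) {n a : G} (hn : n ∈ normalPrimeSet G p)
    (ha : a ∈ normalPrimeSet G p) {P L : Subgroup G} (hnP : n ∈ P) (haP : a ∈ P)
    (hLP : L ⊓ P = ⊥) {y : G} (hy : y ∈ L) {m : ℕ} (hm : y * n * y⁻¹ = n ^ m) :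
    y * a * y⁻¹ = a ^ m := by
  have hLP' : ∀ {x : G}, x ∈ L → x ∈ P → x = 1 := fun hxL hxP =>
    Subgroup.mem_bot.1 (hLP ▸ Subgroup.mem_inf.2 ⟨hxL, hxP⟩)
  have hna : Commute n a :=
    commute_of_mem_normalPrimeSet hp ha (j := 1) (by rw [pow_one, hn.2.1])
  obtain ⟨k, hk⟩ := exists_conj_eq_pow ha.2.2 y
  have hpow : a ∈ Subgroup.zpowers n → y * a * y⁻¹ = a ^ m := by
    rintro ⟨j, rfl⟩
    simp only
    rw [← conj_zpow, hm, ← zpow_natCast, ← zpow_natCast, ← zpow_mul, ← zpow_mul, mul_comm]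
  have : Fact p.Prime := ⟨hp⟩
  by_contra hne
  have han : a ∉ Subgroup.zpowers n := fun h => hne (hpow h)
  have hx : n * a ∈ Subgroup.closure {n * a, y} := Subgroup.subset_closure (Or.inl rfl)
  have hyC : y ∈ Subgroup.closure {n * a, y} := Subgroup.subset_closure (Or.inr rfl)
  have haC : a ∈ Subgroup.closure {n * a, y} := by
    have h1 : a ^ ((k : ℤ) - m) ∈ Subgroup.closure {n * a, y} := by
      have h2 := mul_mem (inv_mem (pow_mem hx m)) (mul_mem (mul_mem hyC hx) (inv_mem hyC))
      have h3 : ((n * a) ^ m)⁻¹ * (y * (n * a) * y⁻¹) = a ^ ((k : ℤ) - m) := by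
        have h4 : y * (n * a) * y⁻¹ = n ^ m * a ^ k := by rw [← hm, ← hk]; group
        rw [h4, hna.mul_pow, mul_inv_rev, sub_eq_neg_add, zpow_add, zpow_neg, zpow_natCast,
          zpow_natCast]
        group
      rwa [h3] at h2
    refine (Subgroup.zpowers_le.2 h1) (mem_zpowers_of_zpow_ne_one hp ha.2.1 fun h => hne ?_)
    rw [hk, ← zpow_natCast, ← zpow_natCast]
    rwa [zpow_sub, mul_inv_eq_one] at h
  have hnC : n ∈ Subgroup.closure {n * a, y} := by
    have := mul_mem hx (inv_mem haC)
    rwa [mul_inv_cancel_right] at this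
  have key : ∀ {u v : G}, (Subgroup.zpowers v).Normal → u ∈ P → v ∈ P →
      u ∈ Subgroup.closure {v, y} → u ∈ Subgroup.zpowers v := by
    intro u v hvn huP hvP hu
    obtain ⟨w, hw, j, hj⟩ := exists_mul_zpow_of_mem_sup
      (Subgroup.normalizer_eq_top_iff.2 hvn ▸ Subgroup.mem_top y)
      (closure_pair_le_sup_zpowers (Subgroup.mem_zpowers v) hu)
    have h1 : y ^ j = 1 := hLP' (zpow_mem hy j)
      ((P.mul_mem_cancel_left (Subgroup.zpowers_le.2 hvP hw)).1 (hj ▸ huP))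
    rwa [← hj, h1, mul_one]
  rcases hG.dependent hnC haC hyC with h | h | h
  · obtain ⟨j, hj⟩ := key ha.2.2 hnP haP h
    refine han (hj ▸ mem_zpowers_of_zpow_ne_one hp ha.2.1 ?_)
    rw [show a ^ j = n from hj]
    exact hn.1
  · exact han (key hn.2.2 haP hnP h)
  · have hy1 : y = 1 := by
      refine hLP' hy ((Subgroup.closure_le P).2 ?_ h)
      rintro x (rfl | rfl)
      · exact hnP
      · exact haP
    refine hne ?_
    rw [hy1, one_mul, inv_one, mul_one] at hm ⊢
    have h1 : orderOf a = orderOf n := by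
      rw [orderOf_eq_prime ha.2.1 ha.1, orderOf_eq_prime hn.2.1 hn.1]
    have h2 : 1 ≡ m [MOD orderOf a] := by
      rw [h1]
      exact pow_eq_pow_iff_modEq.1 ((pow_one n).trans hm)
    exact (pow_one a).symm.trans (pow_eq_pow_iff_modEq.2 h2)

theorem conj_eq_pow_of_mem_closure {G : Type*} [Group G] {A : Set G}
    (hA : ∀ x ∈ Subgroup.closure A, ∀ y ∈ Subgroup.closure A, Commute x y) {y : G} {m : ℕ}
    (h : ∀ a ∈ A, y * a * y⁻¹ = a ^ m) {x : G} (hx : x ∈ Subgroup.closure A) :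
    y * x * y⁻¹ = x ^ m := by
  induction hx using Subgroup.closure_induction with
  | mem a ha => exact h a ha
  | one => simp
  | mul u v hu hv hu' hv' =>
    rw [(hA u hu v hv).mul_pow, ← hu', ← hv']
    group
  | inv u _ hu' => rw [← conj_inv, hu', inv_pow]

theorem mem_zpowers_pow_prime_pow {G : Type*} [Group G] {y : G} {q : ℕ}
    (h : y ∈ Subgroup.zpowers (y ^ q)) (m : ℕ) : y ∈ Subgroup.zpowers (y ^ q ^ m) := by
  induction m with
  | zero => rw [pow_zero, pow_one]; exact Subgroup.mem_zpowers y
  | succ m ih =>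
    refine (Subgroup.zpowers_le.2 ?_) h
    obtain ⟨j, hj⟩ := ih
    refine ⟨j, ?_⟩
    simp only at hj ⊢
    rw [pow_succ, pow_mul, ← zpow_natCast (y ^ q ^ m), ← zpow_mul, mul_comm, zpow_mul, hj,
      zpow_natCast]

theorem IsMatroidGroup.pow_prime_eq_one {G : Type*} [Group G] [Finite G] (hG : IsMatroidGroup G)
    {p : ℕ} {A : Set G} (hAT : A ⊆ normalPrimeSet G p) (hA : IsIndepSet A) {y : G}
    (htop : Subgroup.zpowers y ⊔ Subgroup.closure A = ⊤)
    (hbot : Subgroup.zpowers y ⊓ Subgroup.closure A = ⊥) {q k : ℕ} (hk : y ^ q ^ k = 1) :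
    y ^ q = 1 := by
  by_contra hu
  have hbot' : ∀ j : ℤ, y ^ j ∈ Subgroup.closure A → y ^ j = 1 := fun j hj =>
    Subgroup.mem_bot.1 (hbot ▸ Subgroup.mem_inf.2 ⟨⟨j, rfl⟩, hj⟩)
  have hbotq : ∀ j : ℤ, (y ^ q) ^ j ∈ Subgroup.closure A → (y ^ q) ^ j = 1 := fun j hj => by
    rw [← zpow_natCast, ← zpow_mul] at hj ⊢
    exact hbot' _ hj
  have huA : y ^ q ∉ Subgroup.closure A := fun h => hu (by
    rw [← zpow_natCast] at h ⊢
    exact hbot' _ h)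
  have huA' : y ^ q ∉ A := fun h => huA (Subgroup.subset_closure h)
  have hsup : ∀ {D : Set G} {x : G}, D ⊆ A → x ∈ Subgroup.closure (insert (y ^ q) D) →
      ∃ w ∈ Subgroup.closure D, ∃ j : ℤ, w * (y ^ q) ^ j = x := by
    intro D x hD hx
    have hn := closure_normal_of_subset_normalPrimeSet (hD.trans hAT)
    rw [closure_insert_eq_sup_zpowers] at hx
    exact exists_mul_zpow_of_mem_sup
      (Subgroup.normalizer_eq_top_iff.2 hn ▸ Subgroup.mem_top (y ^ q)) hx
  have hind : IsIndepSet (insert (y ^ q) A) := by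
    rw [isIndepSet_iff]
    rintro x (rfl | hxA) hx
    · rw [Set.insert_sdiff_self_of_notMem huA'] at hx
      exact huA hx
    · have hxu : y ^ q ∉ ({x} : Set G) := fun h => huA' (Set.mem_singleton_iff.1 h ▸ hxA)
      rw [Set.insert_sdiff_of_notMem _ hxu] at hx
      obtain ⟨w, hw, j, hj⟩ := hsup Set.sdiff_subset hx
      have hwA := Subgroup.closure_mono (Set.sdiff_subset : A \ {x} ⊆ A) hw
      have h1 := hbotq j (((Subgroup.closure A).mul_mem_cancel_left hwA).1
        (hj ▸ Subgroup.subset_closure hxA))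
      rw [h1, mul_one] at hj
      exact isIndepSet_iff.1 hA x hxA (hj ▸ hw)
  obtain ⟨Z, hZ, hZmin⟩ := hG.2 _ hind
  obtain ⟨hZtop, hZind⟩ := isMinimalGenSet_iff.1 hZmin
  have hyA : Subgroup.closure (insert y A) = ⊤ := by
    rw [closure_insert_eq_sup_zpowers, sup_comm, htop]
  have hcard : Z.ncard ≤ (insert (y ^ q) A).ncard := by
    refine (hG.ncard_le hZind (B := insert y A) ?_).trans ?_
    · rw [hyA]
      exact fun _ _ => trivial
    · rw [Set.ncard_insert_of_notMem huA']
      exact Set.ncard_insert_le _ _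
  rw [← Set.eq_of_subset_of_ncard_le hZ hcard] at hZtop
  obtain ⟨w, hw, j, hj⟩ := hsup subset_rfl (hZtop ▸ Subgroup.mem_top y)
  have hw1 : w = 1 := by
    have h1 : w = y ^ (1 - (q : ℤ) * j) := by
      rw [zpow_sub, zpow_one, zpow_mul, zpow_natCast, eq_mul_inv_iff_mul_eq, hj]
    rw [h1]
    exact hbot' _ (h1 ▸ hw)
  rw [hw1, one_mul] at hj
  have := mem_zpowers_pow_prime_pow ⟨j, hj⟩ k
  rw [hk, Subgroup.zpowers_one_eq_bot, Subgroup.mem_bot] at this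
  exact hu (by rw [this, one_pow])

open scoped Pointwise in
theorem matroid_group_classification (G : Type*) [Group G] [Finite G]
    (hff : frattini G = ⊥) :
    IsMatroidGroup G ↔
    ((∃ p : ℕ, p.Prime ∧ (∀ x y : G, x * y = y * x) ∧ ∀ x : G, x ^ p = 1) ∨
     (∃ p q : ℕ, p.Prime ∧ q.Prime ∧ q ∣ p - 1 ∧
      ∃ P Q : Subgroup G, P.Normal ∧
        (∀ x ∈ P, ∀ y ∈ P, x * y = y * x) ∧ (∀ x ∈ P, x ^ p = 1) ∧
        IsCyclic Q ∧ Nat.card Q = q ∧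
        P ⊓ Q = ⊥ ∧ (P : Set G) * (Q : Set G) = Set.univ ∧
        ∃ χ : Q →* (ZMod p)ˣ, Function.Injective χ ∧
          ∀ (y : Q) (x : G), x ∈ P →
            (y : G) * x * (y : G)⁻¹ = x ^ ((χ y : ZMod p).val))) := by
  constructor
  · intro hG
    rcases subsingleton_or_nontrivial G with hsub | hnt
    · exact Or.inl ⟨2, Nat.prime_two, fun _ _ => Subsingleton.elim _ _,
        fun _ => Subsingleton.elim _ _⟩
    obtain ⟨p, V, hp, hV, hVp, hV1⟩ := hG.exists_normal_isPGroup
    have : Fact p.Prime := ⟨hp⟩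
    obtain ⟨n, -, hn⟩ := hG.exists_mem_normalPrimeSet hp hV hVp hV1
    obtain ⟨A, P, L, hPn, hP, hAT, hA, hAP, hPo, htop, hbot⟩ := hG.exists_complement hp hn
    have hcomm : ∀ x ∈ P, ∀ y ∈ P, x * y = y * x := fun x hx y hy => ((hPo hx).2.1 y hy).eq
    have hpow : ∀ x ∈ P, x ^ p = 1 := fun x hx => (hPo hx).2.2
    rcases eq_or_ne L ⊥ with rfl | hL1
    · rw [bot_sup_eq] at htop
      exact Or.inl ⟨p, hp, fun x y => hcomm x (htop ▸ trivial) y (htop ▸ trivial),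
        fun x => hpow x (htop ▸ trivial)⟩
    obtain ⟨χ, hχ⟩ := exists_unitsHom_of_mem_normalPrimeSet hp hn
    have hinj : Function.Injective (χ.comp L.subtype) := by
      rw [injective_iff_map_eq_one]
      intro y hy
      have h1 := hχ y
      rw [show χ y = 1 from hy, Units.val_one, ZMod.val_one, pow_one] at h1
      have h2 : (y : G) ∈ L ⊓ P := by
        refine ⟨y.2, ?_⟩
        rw [hPn]
        refine Subgroup.mem_centralizer_iff.2 ?_
        rintro _ ⟨k, rfl⟩
        exact (Commute.zpow_left (mul_inv_eq_iff_eq_mul.1 h1 : Commute (y : G) n).symm k).eq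
      rw [hbot, Subgroup.mem_bot] at h2
      exact Subtype.ext h2
    have hcyc : IsCyclic L := isCyclic_of_injective _ hinj
    obtain ⟨y, rfl⟩ := (Subgroup.isCyclic_iff_exists_zpowers_eq_top L).1 hcyc
    have hy1 : y ≠ 1 := by
      rintro rfl
      exact hL1 Subgroup.zpowers_one_eq_bot
    obtain ⟨q, hq, k, hk⟩ := hG.hasPrimePowerOrders.exists_pow_eq_one y
    have : Fact q.Prime := ⟨hq⟩
    have hyq : y ^ q = 1 := hG.pow_prime_eq_one hAT hA (hAP ▸ htop) (hAP ▸ hbot) hk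
    have hcard : Nat.card (Subgroup.zpowers y) = q := by
      rw [Nat.card_zpowers, orderOf_eq_prime hyq hy1]
    have hnP : n ∈ P := by
      rw [hPn]
      refine Subgroup.mem_centralizer_iff.2 ?_
      rintro _ ⟨k, rfl⟩
      exact (Commute.zpow_left (Commute.refl n) k).eq
    refine Or.inr ⟨p, q, hp, hq, ?_, P, Subgroup.zpowers y, hP, hcomm, hpow, hcyc, hcard,
      inf_comm P _ ▸ hbot, ?_, χ.comp (Subgroup.zpowers y).subtype, hinj, ?_⟩
    · have := Subgroup.card_dvd_of_injective _ hinj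
      rwa [hcard, Nat.card_eq_fintype_card, ZMod.card_units] at this
    · rw [← Subgroup.normal_mul, sup_comm, htop, Subgroup.coe_top]
    · intro z x hx
      refine conj_eq_pow_of_mem_closure (A := A) ?_ (fun a ha => ?_) (hAP ▸ hx)
      · rw [hAP]
        exact hcomm
      · exact hG.conj_eq_pow_of_mem_normalPrimeSet hp hn (hAT ha) hnP
          (hAP ▸ Subgroup.subset_closure ha) hbot z.2 (hχ z)
  · rintro (⟨p, hp, hcomm, hpow⟩ | ⟨p, q, hp, hq, -, P, Q, hP, hcomm, hpow, -, hQ, hPQ, hmul, χ,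
      hχ, hact⟩)
    · exact (hasExchange_of_elementary_abelian hp hcomm hpow).isMatroidGroup
    · refine (hasExchange_of_scalar_action hp hq hP hcomm hpow hQ hPQ (fun g => ?_) χ hχ
        hact).isMatroidGroup
      exact Set.mem_mul.1 (hmul ▸ Set.mem_univ g)
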